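/- arXiv:1809.05775 — 2 statements merged into one kernel-verified Lean document; each statement's English description precedes it below -/
import Mathlib

section
/- Let 1 ≤ i ≤ k < n be integers, K ⊂ ℝⁿ a convex body with centroid at the origin, and E a k-dimensional subspace. Then the i-th dual volume, computed within E, satisfies Ṽ_i(K ∩ E) ≥ ((i+1)/(n+1))^i · max_{x ∈ K} Ṽ_i((K − x) ∩ E). -/
set_option linter.all false
open MeasureTheory
open scoped ENNReal Pointwise

lemma amgm_ennreal {s t : ℝ} (hs : 0 < s) (ht : 0 < t) (hst : s + t = 1) (a b : ℝ≥0∞) :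
    a ^ s * b ^ t ≤ ENNReal.ofReal s * a + ENNReal.ofReal t * b := by
  by_cases ha : a = ⊤
  · have : ENNReal.ofReal s * a = ⊤ := by rw [ha, ENNReal.mul_top]; simpa using hs
    rw [this]; simp
  by_cases hb : b = ⊤
  · have : ENNReal.ofReal t * b = ⊤ := by rw [hb, ENNReal.mul_top]; simpa using ht
    rw [this]; simp
  lift a to NNReal using ha
  lift b to NNReal using hb
  have := NNReal.geom_mean_le_arith_mean2_weighted ⟨s, hs.le⟩ ⟨t, ht.le⟩ a b (by ext; exact hst)
  rw [← ENNReal.coe_rpow_of_nonneg _ hs.le, ← ENNReal.coe_rpow_of_nonneg _ ht.le,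
    ENNReal.ofReal_eq_coe_nnreal hs.le, ENNReal.ofReal_eq_coe_nnreal ht.le]
  exact_mod_cast this

lemma bm1_compact {A B : Set ℝ} (hA : IsCompact A) (hB : IsCompact B) (hA0 : A.Nonempty)
    (hB0 : B.Nonempty) {C : Set ℝ} (hC : ∀ x ∈ A, ∀ y ∈ B, x + y ∈ C) :
    volume A + volume B ≤ volume C := by
  obtain ⟨a, ha, ha'⟩ := hA.exists_isGreatest hA0
  obtain ⟨b, hb, hb'⟩ := hB.exists_isLeast hB0
  have h1 : volume ((fun x => x + b) '' A ∪ (fun y => a + y) '' B) ≤ volume C := by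
    apply measure_mono
    rintro _ (⟨x, hx, rfl⟩ | ⟨y, hy, rfl⟩)
    · exact hC _ hx _ hb
    · exact hC _ ha _ hy
  have h2 : AEDisjoint volume ((fun x => x + b) '' A) ((fun y => a + y) '' B) := by
    refine measure_mono_null (t := {a + b}) ?_ (by simp)
    rintro _ ⟨⟨x, hx, rfl⟩, ⟨y, hy, hxy⟩⟩
    have := ha' hx
    have := hb' hy
    simp only [Set.mem_singleton_iff]
    simp only at hxy
    linarith
  rw [measure_union₀ ?_ h2] at h1
  · simpa using h1
  · exact (hB.image (by fun_prop)).measurableSet.nullMeasurableSet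

lemma bm1 {A B : Set ℝ} (hA : MeasurableSet A) (hB : MeasurableSet B) (hA0 : A.Nonempty)
    (hB0 : B.Nonempty) {C : Set ℝ} (hC : ∀ x ∈ A, ∀ y ∈ B, x + y ∈ C) :
    volume A + volume B ≤ volume C := by
  obtain ⟨a, ha⟩ := hA0
  obtain ⟨b, hb⟩ := hB0
  refine le_of_forall_lt fun r hr => ?_
  by_contra! hcon
  have key : ∀ P ⊆ A, IsCompact P → ∀ Q ⊆ B, IsCompact Q → volume P + volume Q ≤ volume C := by
    intro P hP hPc Q hQ hQc
    calc _ ≤ volume (insert a P) + volume (insert b Q) := by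
          gcongr <;> exact Set.subset_insert _ _
      _ ≤ _ := by
        apply bm1_compact (hPc.insert a) (hQc.insert b) ⟨a, by simp⟩ ⟨b, by simp⟩
        intro x hx y hy
        exact hC _ (Set.insert_subset ha hP hx) _ (Set.insert_subset hb hQ hy)
  have : volume A + volume B ≤ volume C := by
    rw [hA.measure_eq_iSup_isCompact, hB.measure_eq_iSup_isCompact]
    simp only [iSup_and']
    refine ENNReal.biSup_add_biSup_le' (p := fun P => P ⊆ A ∧ IsCompact P) (q := fun P => P ⊆ B ∧ IsCompact P) ⟨∅, by simp⟩ ⟨∅, by simp⟩ ?_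
    exact fun P hP Q hQ => key P hP.1 hP.2 Q hQ.1 hQ.2
  exact absurd (hr.trans_le this) (not_lt.2 hcon)

lemma bm1_comb {s t : ℝ} (hs : 0 < s) (ht : 0 < t) {A B : Set ℝ} (hA : MeasurableSet A)
    (hB : MeasurableSet B) (hA0 : A.Nonempty)
    (hB0 : B.Nonempty) {C : Set ℝ} (hC : ∀ x ∈ A, ∀ y ∈ B, s * x + t * y ∈ C) :
    ENNReal.ofReal s * volume A + ENNReal.ofReal t * volume B ≤ volume C := by
  have h := bm1 (A := s • A) (B := t • B) (hA.const_smul₀ s) (hB.const_smul₀ t)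
    (hA0.smul_set) (hB0.smul_set) (C := C) ?_
  · rw [Measure.addHaar_smul, Measure.addHaar_smul] at h
    simpa [abs_of_pos hs, abs_of_pos ht] using h
  · rintro _ ⟨x, hx, rfl⟩ _ ⟨y, hy, rfl⟩
    exact hC x hx y hy

lemma layer {f : ℝ → ℝ≥0∞} (hf : Measurable f) (hfb : ∀ x, f x ≠ ⊤) :
    ∫⁻ x, f x = ∫⁻ u in Set.Ioi (0:ℝ), volume {x | ENNReal.ofReal u < f x} := by
  have := lintegral_eq_lintegral_meas_lt (volume : Measure ℝ) (f := fun x => (f x).toReal)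
    (Filter.Eventually.of_forall fun x => ENNReal.toReal_nonneg) hf.ennreal_toReal.aemeasurable
  rw [← lintegral_congr (fun x => ENNReal.ofReal_toReal (hfb x)), this]
  refine setLIntegral_congr_fun measurableSet_Ioi fun u hu => ?_
  congr 1
  ext x
  simp only [Set.mem_ofPred_eq]
  rw [ENNReal.ofReal_lt_iff_lt_toReal (le_of_lt hu) (hfb x)]

lemma pl1_norm {s t : ℝ} (hs : 0 < s) (ht : 0 < t) (hst : s + t = 1)
    {f g h : ℝ → ℝ≥0∞} (hf : Measurable f) (hg : Measurable g) (hh : Measurable h)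
    (hf1 : ⨆ x, f x = 1) (hg1 : ⨆ x, g x = 1)
    (H : ∀ x y, f x ^ s * g y ^ t ≤ h (s * x + t * y)) :
    ENNReal.ofReal s * (∫⁻ x, f x) + ENNReal.ofReal t * (∫⁻ x, g x) ≤ ∫⁻ x, h x := by
  have hfl : ∀ x, f x ≤ 1 := fun x => hf1 ▸ le_iSup f x
  have hgl : ∀ x, g x ≤ 1 := fun x => hg1 ▸ le_iSup g x
  have hle : ∫⁻ x, min (h x) 1 ≤ ∫⁻ x, h x := lintegral_mono fun x => min_le_left _ _
  refine le_trans ?_ hle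
  rw [layer hf (fun x => ne_top_of_le_ne_top (by simp) (hfl x)),
    layer hg (fun x => ne_top_of_le_ne_top (by simp) (hgl x)),
    layer (hh.min measurable_const) (fun x => ne_top_of_le_ne_top (by simp) (min_le_right _ _))]
  have mf : Antitone fun u : ℝ => volume {x | ENNReal.ofReal u < f x} := by
    intro u v huv
    exact measure_mono fun x hx => lt_of_le_of_lt (ENNReal.ofReal_le_ofReal huv) hx
  have mg : Antitone fun u : ℝ => volume {x | ENNReal.ofReal u < g x} := by
    intro u v huv
    exact measure_mono fun x hx => lt_of_le_of_lt (ENNReal.ofReal_le_ofReal huv) hx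
  rw [← lintegral_const_mul _ mf.measurable, ← lintegral_const_mul _ mg.measurable,
    ← lintegral_add_left (mf.measurable.const_mul _)]
  refine setLIntegral_mono' measurableSet_Ioi fun u hu => ?_
  have hu : 0 < u := hu
  by_cases hu1 : u < 1
  · have hu1' : ENNReal.ofReal u < 1 := by simpa using hu1
    apply bm1_comb hs ht (measurableSet_lt measurable_const hf)
      (measurableSet_lt measurable_const hg)
    · rw [← hf1] at hu1'
      exact lt_iSup_iff.1 hu1'
    · rw [← hg1] at hu1'
      exact lt_iSup_iff.1 hu1'
    · intro x hx y hy
      simp only [Set.mem_ofPred_eq] at hx hy ⊢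
      refine lt_min (lt_of_lt_of_le ?_ (H x y)) hu1'
      calc ENNReal.ofReal u = ENNReal.ofReal u ^ s * ENNReal.ofReal u ^ t := by
            rw [← ENNReal.rpow_add _ _ (by simpa using hu) (by simp), hst, ENNReal.rpow_one]
        _ < _ := ENNReal.mul_lt_mul (ENNReal.rpow_lt_rpow hx hs) (ENNReal.rpow_lt_rpow hy ht)
  · have h1 : {x | ENNReal.ofReal u < f x} = ∅ := by
      ext x; simp only [Set.mem_ofPred_eq, Set.mem_empty_iff_false, iff_false, not_lt]
      exact (hfl x).trans (by simpa using hu1)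
    have h2 : {x | ENNReal.ofReal u < g x} = ∅ := by
      ext x; simp only [Set.mem_ofPred_eq, Set.mem_empty_iff_false, iff_false, not_lt]
      exact (hgl x).trans (by simpa using hu1)
    simp [h1, h2]

lemma pl1_bdd {s t : ℝ} (hs : 0 < s) (ht : 0 < t) (hst : s + t = 1)
    {f g h : ℝ → ℝ≥0∞} (hf : Measurable f) (hg : Measurable g) (hh : Measurable h)
    (hf1 : ⨆ x, f x ≠ ⊤) (hg1 : ⨆ x, g x ≠ ⊤)
    (H : ∀ x y, f x ^ s * g y ^ t ≤ h (s * x + t * y)) :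
    (∫⁻ x, f x) ^ s * (∫⁻ x, g x) ^ t ≤ ∫⁻ x, h x := by
  set a := ⨆ x, f x with ha
  set b := ⨆ x, g x with hb
  by_cases ha0 : a = 0
  · have : ∀ x, f x = 0 := fun x => by simpa using (le_iSup f x).trans_eq ha0
    simp [this, hs]
  by_cases hb0 : b = 0
  · have : ∀ x, g x = 0 := fun x => by simpa using (le_iSup g x).trans_eq hb0
    simp [this, ht]
  set c := a ^ s * b ^ t with hc
  have hc0 : c ≠ 0 := by
    simp [hc, ha0, hb0, hf1, hg1, ENNReal.rpow_eq_zero_iff]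
  have hct : c ≠ ⊤ := ENNReal.mul_ne_top (ENNReal.rpow_ne_top_of_nonneg hs.le hf1) (ENNReal.rpow_ne_top_of_nonneg ht.le hg1)
  have hcinv : (a⁻¹) ^ s * (b⁻¹) ^ t = c⁻¹ := by
    rw [hc, ENNReal.inv_rpow, ENNReal.inv_rpow, ENNReal.mul_inv]
    · left; simp [ha0, hf1, ENNReal.rpow_eq_zero_iff]
    · left; exact ENNReal.rpow_ne_top_of_nonneg hs.le hf1
  have := pl1_norm hs ht hst (f := fun x => a⁻¹ * f x) (g := fun x => b⁻¹ * g x) (h := fun x => c⁻¹ * h x)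
    (hf.const_mul _) (hg.const_mul _) (hh.const_mul _)
    (by rw [← ENNReal.mul_iSup, ← ha, ENNReal.inv_mul_cancel ha0 hf1])
    (by rw [← ENNReal.mul_iSup, ← hb, ENNReal.inv_mul_cancel hb0 hg1])
    (by
      intro x y
      rw [ENNReal.mul_rpow_of_nonneg _ _ hs.le, ENNReal.mul_rpow_of_nonneg _ _ ht.le]
      calc _ = (a⁻¹ ^ s * b⁻¹ ^ t) * (f x ^ s * g y ^ t) := by ring
        _ ≤ _ := by rw [hcinv]; gcongr; exact H x y)
  rw [lintegral_const_mul _ hf, lintegral_const_mul _ hg, lintegral_const_mul _ hh] at this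
  have h2 := (amgm_ennreal hs ht hst (a⁻¹ * ∫⁻ x, f x) (b⁻¹ * ∫⁻ x, g x)).trans this
  rw [ENNReal.mul_rpow_of_nonneg _ _ hs.le, ENNReal.mul_rpow_of_nonneg _ _ ht.le,
    mul_mul_mul_comm, hcinv] at h2
  exact (ENNReal.mul_le_mul_iff_right (by simpa using hct) (by simpa using hc0)).1 h2

lemma lint_trunc {f : ℝ → ℝ≥0∞} (hf : Measurable f) :
    ∫⁻ x, f x = ⨆ N : ℕ, ∫⁻ x, min (f x) N := by
  rw [← lintegral_iSup (fun N => hf.min measurable_const)]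
  · refine lintegral_congr fun x => ?_
    rw [← inf_iSup_eq, ENNReal.iSup_natCast]; simp
  · intro N M hNM x
    simp only
    gcongr

/-- The Prekopa–Leindler property of a measure. -/
def PLProp {V : Type*} [AddCommGroup V] [Module ℝ V] [MeasurableSpace V] (μ : Measure V) : Prop :=
  ∀ s t : ℝ, 0 < s → 0 < t → s + t = 1 → ∀ f g h : V → ℝ≥0∞, Measurable f → Measurable g →
    Measurable h → (∀ x y, f x ^ s * g y ^ t ≤ h (s • x + t • y)) →
    (∫⁻ x, f x ∂μ) ^ s * (∫⁻ x, g x ∂μ) ^ t ≤ ∫⁻ x, h x ∂μ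

lemma PLProp_real : PLProp (volume : Measure ℝ) := by
  intro s t hs ht hst f g h hf hg hh H
  have key : ∀ N : ℕ, (∫⁻ x, min (f x) N) ^ s * (∫⁻ x, min (g x) N) ^ t ≤ ∫⁻ x, h x := by
    intro N
    apply pl1_bdd hs ht hst (hf.min measurable_const) (hg.min measurable_const) hh
    · exact ne_top_of_le_ne_top (b := N) (by simp) (iSup_le fun x => min_le_right _ _)
    · exact ne_top_of_le_ne_top (b := N) (by simp) (iSup_le fun x => min_le_right _ _)
    · intro x y
      refine le_trans ?_ (H x y)
      gcongr <;> exact min_le_left _ _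
  have lim : ∀ f : ℝ → ℝ≥0∞, Measurable f → Filter.Tendsto (fun N : ℕ => ∫⁻ x, min (f x) N) Filter.atTop
      (nhds (∫⁻ x, f x)) := by
    intro f hf
    rw [lint_trunc hf]
    apply tendsto_atTop_iSup
    intro N M hNM
    refine lintegral_mono fun x => ?_
    simp only
    gcongr
  by_cases hF : ∫⁻ x, f x = 0
  · simp [hF, hs]
  by_cases hG : ∫⁻ x, g x = 0
  · simp [hG, ht]
  refine le_of_tendsto' (ENNReal.Tendsto.mul (((ENNReal.continuous_rpow_const (y := s)).tendsto _).comp (lim f hf)) ?_ (((ENNReal.continuous_rpow_const (y := t)).tendsto _).comp (lim g hg)) ?_) key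
  · left; simp [hF, ENNReal.rpow_eq_zero_iff, not_lt.2 hs.le]
  · left; simp [hG, ENNReal.rpow_eq_zero_iff, not_lt.2 ht.le]

lemma PLProp_prod {V W : Type*} [AddCommGroup V] [Module ℝ V] [MeasurableSpace V]
    [AddCommGroup W] [Module ℝ W] [MeasurableSpace W] {μ : Measure V} {ν : Measure W} [SFinite ν] [SFinite μ]
    (hμ : PLProp μ) (hν : PLProp ν) : PLProp (μ.prod ν) := by
  intro s t hs ht hst f g h hf hg hh H
  rw [lintegral_prod _ hf.aemeasurable, lintegral_prod _ hg.aemeasurable,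
    lintegral_prod _ hh.aemeasurable]
  apply hμ s t hs ht hst _ _ _ hf.lintegral_prod_right' hg.lintegral_prod_right' hh.lintegral_prod_right'
  intro x y
  apply hν s t hs ht hst _ _ _ (hf.comp measurable_prodMk_left) (hg.comp measurable_prodMk_left) (hh.comp measurable_prodMk_left)
  intro z w
  exact H (x, z) (y, w)

lemma PLProp_map {V W : Type*} [AddCommGroup V] [Module ℝ V] [MeasurableSpace V]
    [AddCommGroup W] [Module ℝ W] [MeasurableSpace W] {μ : Measure V} {ν : Measure W}
    (L : V →ₗ[ℝ] W) (hL : MeasurePreserving L μ ν) (hμ : PLProp μ) : PLProp ν := by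
  intro s t hs ht hst f g h hf hg hh H
  rw [← hL.lintegral_comp hf, ← hL.lintegral_comp hg, ← hL.lintegral_comp hh]
  apply hμ s t hs ht hst _ _ _ (hf.comp hL.measurable) (hg.comp hL.measurable) (hh.comp hL.measurable)
  intro x y
  simpa using H (L x) (L y)

lemma PLProp_pi (n : ℕ) : PLProp (volume : Measure (Fin n → ℝ)) := by
  induction n with
  | zero =>
    intro s t hs ht hst f g h hf hg hh H
    have : ∀ f : (Fin 0 → ℝ) → ℝ≥0∞, ∫⁻ x, f x = f 0 := by
      intro f
      rw [lintegral_unique]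
      have : (volume : Measure (Fin 0 → ℝ)) Set.univ = 1 := by simp [volume_pi]
      rw [this, mul_one]; congr 1; exact Subsingleton.elim _ _
    rw [this, this, this]
    simpa using H 0 0
  | succ n ih =>
    have e := (volume_preserving_piFinSuccAbove (fun _ : Fin (n + 1) => ℝ) 0).symm
    let L : (ℝ × (Fin n → ℝ)) →ₗ[ℝ] (Fin (n + 1) → ℝ) :=
      { toFun := (MeasurableEquiv.piFinSuccAbove (fun _ : Fin (n + 1) => ℝ) 0).symm
        map_add' := by
          intro x y
          ext j
          refine Fin.cases ?_ (fun j => ?_) j <;> simp [MeasurableEquiv.piFinSuccAbove, Fin.insertNthEquiv]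
        map_smul' := by
          intro x y
          ext j
          refine Fin.cases ?_ (fun j => ?_) j <;> simp [MeasurableEquiv.piFinSuccAbove, Fin.insertNthEquiv] }
    exact PLProp_map L e (PLProp_prod PLProp_real ih)

lemma PLProp_smul {V : Type*} [AddCommGroup V] [Module ℝ V] [MeasurableSpace V] {μ : Measure V}
    (hμ : PLProp μ) (c : ℝ≥0∞) (hc : c ≠ ⊤) : PLProp (c • μ) := by
  intro s t hs ht hst f g h hf hg hh H
  simp only [lintegral_smul_measure, smul_eq_mul]
  have := hμ s t hs ht hst f g h hf hg hh H
  by_cases hc0 : c = 0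
  · simp [hc0, hs]
  rw [ENNReal.mul_rpow_of_nonneg _ _ hs.le, ENNReal.mul_rpow_of_nonneg _ _ ht.le, mul_mul_mul_comm,
    ← ENNReal.rpow_add _ _ hc0 hc, hst, ENNReal.rpow_one]
  gcongr

/-- Prekopa–Leindler for the volume of Euclidean space. -/
lemma PLProp_euclidean (n : ℕ) : PLProp (volume : Measure (EuclideanSpace ℝ (Fin n))) :=
  PLProp_map (WithLp.linearEquiv 2 ℝ (Fin n → ℝ)).symm.toLinearMap
    (EuclideanSpace.volume_preserving_symm_measurableEquiv_toLp (Fin n)).symm (PLProp_pi n)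

open MeasureTheory
open scoped ENNReal Pointwise
set_option linter.all false
set_option linter.unusedSectionVars false
set_option linter.unusedVariables false

lemma bm_mul {i : ℕ} {s t : ℝ} (hs : 0 < s) (ht : 0 < t) (hst : s + t = 1)
    {A B C : Set (EuclideanSpace ℝ (Fin i))} (hA : MeasurableSet A) (hB : MeasurableSet B)
    (hC : MeasurableSet C) (H : ∀ x ∈ A, ∀ y ∈ B, s • x + t • y ∈ C) :
    volume A ^ s * volume B ^ t ≤ volume C := by
  have := PLProp_euclidean i s t hs ht hst (A.indicator 1) (B.indicator 1) (C.indicator 1)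
    (measurable_one.indicator hA) (measurable_one.indicator hB) (measurable_one.indicator hC) ?_
  · simpa [lintegral_indicator_one, hA, hB, hC] using this
  · intro x y
    by_cases hx : x ∈ A
    · by_cases hy : y ∈ B
      · simp [hx, hy, H x hx y hy]
      · simp [hy, ht]
    · simp [hx, hs]

/-- Brunn–Minkowski. -/
lemma bm_add {i : ℕ} (hi : 1 ≤ i) {s t : ℝ} (hs : 0 < s) (ht : 0 < t) (hst : s + t = 1)
    {A B C : Set (EuclideanSpace ℝ (Fin i))} (hA : MeasurableSet A) (hB : MeasurableSet B)
    (hC : MeasurableSet C) (hA0 : A.Nonempty) (hB0 : B.Nonempty)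
    (hCf : volume C ≠ ⊤) (H : ∀ x ∈ A, ∀ y ∈ B, s • x + t • y ∈ C) :
    s * (volume.real A) ^ ((i : ℝ)⁻¹) + t * (volume.real B) ^ ((i : ℝ)⁻¹) ≤
      (volume.real C) ^ ((i : ℝ)⁻¹) := by
  have hi0 : i ≠ 0 := by omega
  set α := (volume.real A) ^ ((i : ℝ)⁻¹) with hα
  set β := (volume.real B) ^ ((i : ℝ)⁻¹) with hβ
  have hαi : α ^ i = volume.real A := Real.rpow_inv_natCast_pow measureReal_nonneg hi0
  have hβi : β ^ i = volume.real B := Real.rpow_inv_natCast_pow measureReal_nonneg hi0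
  have hα0 : 0 ≤ α := by positivity
  have hβ0 : 0 ≤ β := by positivity
  have hsc : ∀ (c : ℝ), 0 ≤ c → ∀ S : Set (EuclideanSpace ℝ (Fin i)), volume.real (c • S) = c ^ i * volume.real S := by
    intro c hc S
    rw [measureReal_def, Measure.addHaar_smul]
    simp [abs_of_nonneg hc, measureReal_def, hc]
  suffices h : (s * α + t * β) ^ i ≤ volume.real C by
    rw [← Real.pow_rpow_inv_natCast (by positivity : 0 ≤ s * α + t * β) hi0]
    gcongr
  rcases eq_or_lt_of_le hα0 with h0 | hαp
  · obtain ⟨a, ha⟩ := hA0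
    have : volume.real ((s • a) +ᵥ t • B) ≤ volume.real C := by
      apply measureReal_mono _ hCf
      rintro _ ⟨_, ⟨y, hy, rfl⟩, rfl⟩
      exact H a ha y hy
    rw [measureReal_def, measure_vadd, ← measureReal_def, hsc _ ht.le, ← hβi] at this
    rw [← h0]; simpa [mul_pow] using this
  rcases eq_or_lt_of_le hβ0 with h0 | hβp
  · obtain ⟨b, hb⟩ := hB0
    have : volume.real ((t • b) +ᵥ s • A) ≤ volume.real C := by
      apply measureReal_mono _ hCf
      rintro _ ⟨_, ⟨x, hx, rfl⟩, rfl⟩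
      have := H x hx b hb
      rw [add_comm] at this
      exact this
    rw [measureReal_def, measure_vadd, ← measureReal_def, hsc _ hs.le, ← hαi] at this
    rw [← h0]; simpa [mul_pow] using this
  set σ := s * α + t * β with hσ
  have hσp : 0 < σ := by positivity
  have key := bm_mul (s := s * α / σ) (t := t * β / σ) (by positivity) (by positivity)
    (by rw [← add_div, ← hσ]; exact div_self hσp.ne') (A := α⁻¹ • A) (B := β⁻¹ • B) (C := σ⁻¹ • C)
    (hA.const_smul₀ _) (hB.const_smul₀ _) (hC.const_smul₀ _) (by
      rintro _ ⟨x, hx, rfl⟩ _ ⟨y, hy, rfl⟩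
      refine ⟨_, H x hx y hy, ?_⟩
      simp only [smul_add, smul_smul]
      congr 2 <;> field_simp)
  have one : ∀ (γ : ℝ) (S : Set (EuclideanSpace ℝ (Fin i))), 0 < γ → γ ^ i = volume.real S → volume (γ⁻¹ • S) = 1 := by
    intro γ S hγ h
    have : volume.real (γ⁻¹ • S) = 1 := by
      rw [hsc _ (by positivity), ← h, ← mul_pow, inv_mul_cancel₀ hγ.ne', one_pow]
    rw [measureReal_def] at this
    rwa [ENNReal.toReal_eq_one_iff] at this
  rw [one α A hαp hαi, one β B hβp hβi] at key
  simp only [ENNReal.one_rpow, mul_one] at key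
  have h2 : 1 ≤ volume.real (σ⁻¹ • C) := by
    rw [measureReal_def]
    rw [← ENNReal.toReal_one]
    refine ENNReal.toReal_mono ?_ key
    rw [Measure.addHaar_smul]
    exact ENNReal.mul_ne_top (by simp) hCf
  rw [hsc _ (by positivity)] at h2
  rwa [inv_pow, ← div_eq_inv_mul, one_le_div (by positivity)] at h2

section fradelizi

variable {Y : Type*} [NormedAddCommGroup Y] [NormedSpace ℝ Y] [FiniteDimensional ℝ Y]
  [MeasurableSpace Y] [BorelSpace Y] {i : ℕ}

/-- The `i`-th root of the section volume. -/
noncomputable def secRoot (K : Set (Y × EuclideanSpace ℝ (Fin i))) (y : Y) : ℝ :=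
  (volume.real (Prod.mk y ⁻¹' K)) ^ ((i : ℝ)⁻¹)

lemma secRoot_nonneg (K : Set (Y × EuclideanSpace ℝ (Fin i))) (y : Y) : 0 ≤ secRoot K y := by
  unfold secRoot; positivity

lemma secRoot_pow (hi : 1 ≤ i) (K : Set (Y × EuclideanSpace ℝ (Fin i))) (y : Y) :
    secRoot K y ^ i = volume.real (Prod.mk y ⁻¹' K) :=
  Real.rpow_inv_natCast_pow measureReal_nonneg (by omega)

lemma sec_compact {K : Set (Y × EuclideanSpace ℝ (Fin i))} (hK : IsCompact K) (y : Y) :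
    IsCompact (Prod.mk y ⁻¹' K) := by
  refine (hK.image continuous_snd).of_isClosed_subset (hK.isClosed.preimage (by fun_prop)) ?_
  intro z hz
  exact ⟨(y, z), hz, rfl⟩

lemma secRoot_of_notMem (hi : 1 ≤ i) {K : Set (Y × EuclideanSpace ℝ (Fin i))} {y : Y} (hy : y ∉ Prod.fst '' K) :
    secRoot K y = 0 := by
  have : Prod.mk y ⁻¹' K = ∅ := by
    ext z
    simp only [Set.mem_preimage, Set.mem_empty_iff_false, iff_false]
    intro h
    exact hy ⟨_, h, rfl⟩
  have : (i : ℝ) ≠ 0 := by positivity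
  simp [secRoot, *]

lemma secRoot_bdd {K : Set (Y × EuclideanSpace ℝ (Fin i))} (hK : IsCompact K) :
    ∃ M, ∀ y, secRoot K y ≤ M := by
  refine ⟨(volume.real (Prod.snd '' K)) ^ ((i : ℝ)⁻¹), fun y => ?_⟩
  unfold secRoot
  gcongr
  · exact (hK.image continuous_snd).measure_ne_top
  · intro z hz
    exact ⟨(y, z), hz, rfl⟩

lemma secRoot_measurable {K : Set (Y × EuclideanSpace ℝ (Fin i))} (hK : MeasurableSet K) :
    Measurable (secRoot K) :=
  ((measurable_measure_prodMk_left hK).ennreal_toReal).pow_const _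

lemma secRoot_concave (hi : 1 ≤ i) {K : Set (Y × EuclideanSpace ℝ (Fin i))} (hK : IsCompact K)
    (hKc : Convex ℝ K) : ConcaveOn ℝ (Prod.fst '' K) (secRoot K) := by
  rw [concaveOn_iff_forall_pos]
  refine ⟨hKc.linear_image (LinearMap.fst ℝ Y _), ?_⟩
  rintro _ ⟨⟨x, z⟩, hx, rfl⟩ _ ⟨⟨y, w⟩, hy, rfl⟩ a b ha hb hab
  refine bm_add hi ha hb hab (sec_compact hK _).measurableSet (sec_compact hK _).measurableSet
    (sec_compact hK _).measurableSet ⟨z, hx⟩ ⟨w, hy⟩ (sec_compact hK _).measure_ne_top ?_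
  intro p hp q hq
  exact hKc hp hq ha.le hb.le hab

lemma secRoot_usc (hi : 1 ≤ i) {K : Set (Y × EuclideanSpace ℝ (Fin i))} (hK : IsCompact K) :
    UpperSemicontinuous (secRoot K) := by
  intro y c hc
  have hc0 : 0 < c := (secRoot_nonneg K y).trans_lt hc
  have h1 : volume (Prod.mk y ⁻¹' K) < ENNReal.ofReal (c ^ i) := by
    rw [ENNReal.lt_ofReal_iff_toReal_lt (sec_compact hK y).measure_ne_top, ← measureReal_def,
      ← secRoot_pow hi]
    exact pow_lt_pow_left₀ hc (secRoot_nonneg K y) (by omega)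
  obtain ⟨U, hKU, hU, hUc⟩ := Set.exists_isOpen_lt_of_lt _ _ h1
  have hcl : IsClosed (Prod.fst '' (K \ (Prod.snd ⁻¹' U))) :=
    ((hK.diff (hU.preimage continuous_snd)).image continuous_fst).isClosed
  have hy : y ∈ (Prod.fst '' (K \ (Prod.snd ⁻¹' U)))ᶜ := by
    rintro ⟨⟨y', z⟩, ⟨h, h'⟩, rfl⟩
    exact h' (hKU h)
  filter_upwards [hcl.isOpen_compl.mem_nhds hy] with y' hy'
  have h2 : volume (Prod.mk y' ⁻¹' K) < ENNReal.ofReal (c ^ i) := by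
    refine lt_of_le_of_lt (measure_mono ?_) hUc
    intro z hz
    by_contra hzU
    exact hy' ⟨(y', z), ⟨hz, hzU⟩, rfl⟩
  rw [ENNReal.lt_ofReal_iff_toReal_lt (sec_compact hK y').measure_ne_top, ← measureReal_def,
      ← secRoot_pow hi] at h2
  exact lt_of_pow_lt_pow_left₀ i hc0.le h2

variable (μ : Measure Y) [μ.IsAddHaarMeasure]

lemma secRoot_jensen (hi : 1 ≤ i) {K : Set (Y × EuclideanSpace ℝ (Fin i))} (hK : IsCompact K)
    (hKc : Convex ℝ K) (hK0 : μ.prod volume K ≠ 0) (hcent : ∫ p in K, p.1 ∂(μ.prod volume) = 0) :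
    ∫ p in K, secRoot K p.1 ∂(μ.prod volume) ≤ (μ.prod volume).real K * secRoot K 0 := by
  have hcl : IsClosed {p : Y × ℝ | p.1 ∈ Prod.fst '' K ∧ p.2 ≤ secRoot K p.1} :=
    (upperSemicontinuousOn_iff_isClosed_hypograph (hK.image continuous_fst).isClosed).1
      ((secRoot_usc hi hK).upperSemicontinuousOn _)
  have hKt : μ.prod volume K ≠ ⊤ := hK.measure_ne_top
  have i1 : IntegrableOn (fun p : Y × EuclideanSpace ℝ (Fin i) => p.1) K (μ.prod volume) :=
    continuous_fst.continuousOn.integrableOn_compact hK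
  have i2 : IntegrableOn (fun p : Y × EuclideanSpace ℝ (Fin i) => secRoot K p.1) K (μ.prod volume) := by
    obtain ⟨M, hM⟩ := secRoot_bdd hK
    refine Measure.integrableOn_of_bounded (M := M) hKt
      ((secRoot_measurable hK.measurableSet).comp measurable_fst).aestronglyMeasurable ?_
    filter_upwards with p
    rw [Real.norm_of_nonneg (secRoot_nonneg _ _)]
    exact hM _
  have := ((secRoot_concave hi hK hKc).convex_hypograph).set_average_mem hcl hK0 hKt
    (f := fun p : Y × EuclideanSpace ℝ (Fin i) => (p.1, secRoot K p.1))
    (by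
      filter_upwards [ae_restrict_mem hK.measurableSet] with p hp
      exact ⟨⟨p, hp, rfl⟩, le_rfl⟩) (i1.prodMk i2)
  rw [setAverage_eq, integral_pair i1 i2, hcent] at this
  have h2 := this.2
  simp only [Prod.smul_mk, smul_zero, smul_eq_mul] at h2
  have hp : 0 < (μ.prod volume).real K := ENNReal.toReal_pos hK0 hKt
  rwa [inv_mul_le_iff₀ hp] at h2

lemma int_fst (hi : 1 ≤ i) {K : Set (Y × EuclideanSpace ℝ (Fin i))} (hK : IsCompact K) :
    (μ.prod volume).real K = ∫ y, secRoot K y ^ i ∂μ := by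
  rw [measureReal_def, Measure.prod_apply hK.measurableSet]
  simp_rw [secRoot_pow hi, measureReal_def]
  rw [integral_toReal (measurable_measure_prodMk_left hK.measurableSet).aemeasurable]
  filter_upwards with y
  exact (sec_compact hK y).measure_lt_top

lemma int_fst' (hi : 1 ≤ i) {K : Set (Y × EuclideanSpace ℝ (Fin i))} (hK : IsCompact K) :
    ∫ p in K, secRoot K p.1 ∂(μ.prod volume) = ∫ y, secRoot K y ^ (i + 1) ∂μ := by
  have i2 : IntegrableOn (fun p : Y × EuclideanSpace ℝ (Fin i) => secRoot K p.1) K (μ.prod volume) := by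
    obtain ⟨M, hM⟩ := secRoot_bdd hK
    refine Measure.integrableOn_of_bounded (M := M) hK.measure_ne_top
      ((secRoot_measurable hK.measurableSet).comp measurable_fst).aestronglyMeasurable ?_
    filter_upwards with p
    rw [Real.norm_of_nonneg (secRoot_nonneg _ _)]
    exact hM _
  rw [← integral_indicator hK.measurableSet, integral_prod _ (by rwa [integrable_indicator_iff hK.measurableSet])]
  congr 1
  ext y
  have : ∀ z, K.indicator (fun p : Y × EuclideanSpace ℝ (Fin i) => secRoot K p.1) (y, z) =
    (Prod.mk y ⁻¹' K).indicator (fun _ => secRoot K y) z := fun z => rfl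
  simp_rw [this]
  rw [integral_indicator (sec_compact hK y).measurableSet, setIntegral_const, ← secRoot_pow hi, pow_succ, smul_eq_mul]

lemma pow_add_ge (j : ℕ) {a b : ℝ} (ha : 0 ≤ a) (hb : 0 ≤ b) :
    a ^ (j + 1) + (j + 1) * a ^ j * b ≤ (a + b) ^ (j + 1) := by
  induction j with
  | zero => simp
  | succ j ih =>
    have h := mul_le_mul_of_nonneg_right ih (add_nonneg ha hb)
    have : 0 ≤ ((j:ℝ) + 1) * a ^ j * b * b := by positivity
    rw [pow_succ (a + b)]
    push_cast
    ring_nf at *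
    linarith

lemma secRoot_integrable (hi : 1 ≤ i) {K : Set (Y × EuclideanSpace ℝ (Fin i))} (hK : IsCompact K) (j : ℕ)
    (hj : j ≠ 0) : Integrable (fun y => secRoot K y ^ j) μ := by
  obtain ⟨M, hM⟩ := secRoot_bdd hK
  have hD := hK.image (continuous_fst)
  have : IntegrableOn (fun y => secRoot K y ^ j) (Prod.fst '' K) μ := by
    refine Measure.integrableOn_of_bounded (M := M ^ j) hD.measure_ne_top
      ((secRoot_measurable hK.measurableSet).pow_const j).aestronglyMeasurable ?_
    filter_upwards with y
    rw [Real.norm_of_nonneg (pow_nonneg (secRoot_nonneg _ _) _)]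
    exact pow_le_pow_left₀ (secRoot_nonneg _ _) (hM y) j
  refine this.integrable_of_forall_notMem_eq_zero ?_
  intro y hy
  rw [secRoot_of_notMem hi hy, zero_pow hj]

lemma secRoot_scale (hi : 1 ≤ i) {K : Set (Y × EuclideanSpace ℝ (Fin i))} (hK : IsCompact K)
    (hKc : Convex ℝ K) {y₀ : Y} (hy₀ : y₀ ∈ Prod.fst '' K) {l : ℝ} (hl : 0 < l) (hl1 : l < 1) :
    l ^ (Module.finrank ℝ Y) * (l ^ (i + 1) * (∫ y, secRoot K y ^ (i + 1) ∂μ) +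
      (i + 1) * l ^ i * ((1 - l) * secRoot K y₀) * ∫ y, secRoot K y ^ i ∂μ) ≤
    ∫ y, secRoot K y ^ (i + 1) ∂μ := by
  set m := Module.finrank ℝ Y
  have hcv : ∫ y, secRoot K ((1 - l) • y₀ + l • y) ^ (i + 1) ∂μ =
      (l ^ m)⁻¹ * ∫ y, secRoot K y ^ (i + 1) ∂μ := by
    rw [Measure.integral_comp_smul μ (fun y => secRoot K ((1 - l) • y₀ + y) ^ (i + 1)) l,
      integral_add_left_eq_self (fun y => secRoot K y ^ (i + 1)), abs_of_pos (by positivity), smul_eq_mul]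
  have hIntg := secRoot_integrable μ hi hK (i + 1) (by omega)
  have hIntg' := secRoot_integrable μ hi hK i (by omega)
  have hint2 : Integrable (fun y => secRoot K ((1 - l) • y₀ + l • y) ^ (i + 1)) μ :=
    (hIntg.comp_add_left ((1 - l) • y₀)).comp_smul hl.ne'
  have hmono : ∫ y, (l ^ (i + 1) * secRoot K y ^ (i + 1) +
      (i + 1) * l ^ i * ((1 - l) * secRoot K y₀) * secRoot K y ^ i) ∂μ ≤
      ∫ y, secRoot K ((1 - l) • y₀ + l • y) ^ (i + 1) ∂μ := by
    refine integral_mono ((hIntg.const_mul _).add (hIntg'.const_mul _)) hint2 fun y => ?_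
    by_cases hy : y ∈ Prod.fst '' K
    · have h1 := (secRoot_concave hi hK hKc).2 hy₀ hy (by linarith : 0 ≤ 1 - l) hl.le (by ring)
      have h2 := pow_add_ge i (a := l * secRoot K y) (b := (1 - l) * secRoot K y₀)
        (mul_nonneg hl.le (secRoot_nonneg _ _)) (mul_nonneg (by linarith) (secRoot_nonneg _ _))
      simp only [smul_eq_mul] at h1
      refine le_trans (le_of_eq ?_) (h2.trans (pow_le_pow_left₀ ?_ (by linarith) _))
      · ring
      · exact add_nonneg (mul_nonneg hl.le (secRoot_nonneg _ _)) (mul_nonneg (by linarith) (secRoot_nonneg _ _))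
    · have h0 : i ≠ 0 := by omega
      simp only [secRoot_of_notMem hi hy]
      simpa [h0] using pow_nonneg (secRoot_nonneg _ _) _
  rw [integral_add (hIntg.const_mul _) (hIntg'.const_mul _), integral_const_mul, integral_const_mul, hcv] at hmono
  rwa [← div_eq_inv_mul, le_div_iff₀' (by positivity)] at hmono

lemma secRoot_moment (hi : 1 ≤ i) {K : Set (Y × EuclideanSpace ℝ (Fin i))} (hK : IsCompact K)
    (hKc : Convex ℝ K) {y₀ : Y} (hy₀ : y₀ ∈ Prod.fst '' K) :
    (i + 1) * secRoot K y₀ * (∫ y, secRoot K y ^ i ∂μ) ≤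
      (Module.finrank ℝ Y + i + 1) * ∫ y, secRoot K y ^ (i + 1) ∂μ := by
  set m := Module.finrank ℝ Y
  set P := ∫ y, secRoot K y ^ (i + 1) ∂μ
  set Q := ∫ y, secRoot K y ^ i ∂μ
  have key : ∀ l ∈ Set.Ioo (0:ℝ) 1, l ^ (m + i) * ((i + 1) * secRoot K y₀ * Q) ≤
      (∑ j ∈ Finset.range (m + i + 1), l ^ j) * P := by
    rintro l ⟨hl, hl1⟩
    have := secRoot_scale μ hi hK hKc hy₀ hl hl1
    have hg := geom_sum_mul_neg l (m + i + 1)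
    have h1l : 0 < 1 - l := by linarith
    refine le_of_mul_le_mul_right ?_ h1l
    have e : (∑ j ∈ Finset.range (m + i + 1), l ^ j) * P * (1 - l) = (1 - l ^ (m + i + 1)) * P := by
      rw [← hg]; ring
    rw [e]
    have e2 : l ^ m * (l ^ (i + 1) * P + (i + 1) * l ^ i * ((1 - l) * secRoot K y₀) * Q) =
      l ^ (m + i + 1) * P + l ^ (m + i) * ((i + 1) * secRoot K y₀ * Q) * (1 - l) := by ring
    rw [e2] at this
    linarith
  have hcl : (1:ℝ) ∈ closure (Set.Ioo (0:ℝ) 1) := by rw [closure_Ioo (by norm_num)]; simp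
  have := le_on_closure (s := Set.Ioo (0:ℝ) 1) key (by fun_prop) (by fun_prop) hcl
  simpa using this

theorem fradelizi (hi : 1 ≤ i) {K : Set (Y × EuclideanSpace ℝ (Fin i))} (hK : IsCompact K)
    (hKc : Convex ℝ K) (hK0 : μ.prod volume K ≠ 0) (hcent : ∫ p in K, p.1 ∂(μ.prod volume) = 0) (y₀ : Y) :
    ENNReal.ofReal (((i + 1) / (Module.finrank ℝ Y + i + 1)) ^ i) * volume (Prod.mk y₀ ⁻¹' K) ≤
      volume (Prod.mk 0 ⁻¹' K) := by
  have hr : ((i + 1 : ℝ) / (Module.finrank ℝ Y + i + 1)) ^ i * volume.real (Prod.mk y₀ ⁻¹' K) ≤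
      volume.real (Prod.mk 0 ⁻¹' K) := by
    rw [← secRoot_pow hi, ← secRoot_pow hi, ← mul_pow]
    refine pow_le_pow_left₀ (mul_nonneg (by positivity) (secRoot_nonneg _ _)) ?_ _
    by_cases hy₀ : y₀ ∈ Prod.fst '' K
    · have h1 := secRoot_moment μ hi hK hKc hy₀
      have h2 := secRoot_jensen μ hi hK hKc hK0 hcent
      rw [← int_fst' μ hi hK, ← int_fst μ hi hK] at h1
      have hp : 0 < (μ.prod volume).real K := ENNReal.toReal_pos hK0 hK.measure_ne_top
      rw [div_mul_eq_mul_div, div_le_iff₀ (by positivity)]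
      refine le_of_mul_le_mul_right ?_ hp
      have hm : (0:ℝ) ≤ Module.finrank ℝ Y + i + 1 := by positivity
      nlinarith [mul_le_mul_of_nonneg_left h2 hm]
    · rw [secRoot_of_notMem hi hy₀, mul_zero]; exact secRoot_nonneg _ _
  rw [← ofReal_measureReal (sec_compact hK y₀).measure_ne_top, ← ofReal_measureReal (sec_compact hK 0).measure_ne_top,
    ← ENNReal.ofReal_mul (by positivity)]
  exact ENNReal.ofReal_le_ofReal hr

end fradelizi

open MeasureTheory
open scoped ENNReal Pointwise
set_option linter.all false

lemma fradelizi_map {n i : ℕ} (hi : 1 ≤ i) {K : Set (EuclideanSpace ℝ (Fin n))}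
    (hKconv : Convex ℝ K) (hKcomp : IsCompact K) (hKint : (interior K).Nonempty)
    (hcentroid : (∫ x in K, x) = 0) (A : EuclideanSpace ℝ (Fin i) →ₗ[ℝ] EuclideanSpace ℝ (Fin n))
    (hA : Function.Injective A) (x : EuclideanSpace ℝ (Fin n)) :
    ENNReal.ofReal (((i + 1 : ℝ) / (n + 1)) ^ i) * volume (A ⁻¹' ((fun z => z - x) '' K)) ≤
      volume (A ⁻¹' K) := by
  obtain ⟨Y, hY⟩ := Submodule.exists_isCompl (LinearMap.range A)
  let L₀ : (Y × EuclideanSpace ℝ (Fin i)) ≃ₗ[ℝ] EuclideanSpace ℝ (Fin n) :=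
    (LinearEquiv.prodCongr (LinearEquiv.refl ℝ Y) (LinearEquiv.ofInjective A hA)).trans
      (Submodule.prodEquivOfIsCompl Y (LinearMap.range A) hY.symm)
  have hL₀ : ∀ p, L₀ p = (p.1 : EuclideanSpace ℝ (Fin n)) + A p.2 := by
    intro p
    simp [L₀]
  let L : (Y × EuclideanSpace ℝ (Fin i)) ≃L[ℝ] EuclideanSpace ℝ (Fin n) := L₀.toContinuousLinearEquiv
  have hL : ∀ p, L p = (p.1 : EuclideanSpace ℝ (Fin n)) + A p.2 := hL₀
  have hdim : Module.finrank ℝ Y + i = n := by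
    have := L₀.finrank_eq
    simpa using this
  let μ : Measure Y := volume
  have hmap : ∃ c : ℝ≥0∞, c ≠ ⊤ ∧ (μ.prod volume).map L = c • volume := by
    haveI : ((μ.prod volume).map L).IsAddHaarMeasure := L.isAddHaarMeasure_map _
    refine ⟨_, ?_, Measure.isAddLeftInvariant_eq_smul ((μ.prod volume).map L) volume⟩
    simp
  obtain ⟨c, hc, hmap⟩ := hmap
  set K' := L ⁻¹' K with hK'
  have hK'c : IsCompact K' := by
    rw [hK', ← L.image_symm_eq_preimage]
    exact hKcomp.image L.symm.continuous
  have hK'conv : Convex ℝ K' := hKconv.linear_preimage L₀.toLinearMap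
  have hK'0 : μ.prod volume K' ≠ 0 := by
    have : (interior K').Nonempty := by
      obtain ⟨w, hw⟩ := hKint
      refine ⟨L.symm w, ?_⟩
      refine (interior_maximal (t := L ⁻¹' (interior K)) (Set.preimage_mono interior_subset)
        (isOpen_interior.preimage L.continuous)) ?_
      simpa using hw
    exact (Measure.measure_pos_of_nonempty_interior _ this).ne'
  have hcent : ∫ p in K', p.1 ∂(μ.prod volume) = 0 := by
    let P : EuclideanSpace ℝ (Fin n) →L[ℝ] Y := (ContinuousLinearMap.fst ℝ Y (EuclideanSpace ℝ (Fin i))).comp (L.symm : _ →L[ℝ] _)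
    have h1 : ∫ p in K', p.1 ∂(μ.prod volume) = ∫ p in L ⁻¹' K, P (L p) ∂(μ.prod volume) := by
      congr 1
      ext p
      simp [P]
    rw [h1, ← (L.toHomeomorph.measurableEmbedding).setIntegral_map (μ := μ.prod volume) (f := L) (fun w => P w) K, hmap,
      Measure.restrict_smul, integral_smul_measure, P.integral_comp_comm, hcentroid]
    · simp
    · exact continuousOn_id.integrableOn_compact hKcomp
  have key := fradelizi μ hi hK'c hK'conv hK'0 hcent (L.symm x).1
  have e0 : volume (A ⁻¹' K) = volume (Prod.mk (0 : Y) ⁻¹' K') := by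
    congr 1
    ext z
    simp [hK', hL]
  have e1 : volume (A ⁻¹' ((fun z => z - x) '' K)) = volume (Prod.mk (L.symm x).1 ⁻¹' K') := by
    rw [← measure_preimage_add_right volume (L.symm x).2 (Prod.mk (L.symm x).1 ⁻¹' K')]
    congr 1
    ext z
    have hx : x = ((L.symm x).1 : EuclideanSpace ℝ (Fin n)) + A (L.symm x).2 := by
      rw [← hL]; simp
    have h2 : L ((L.symm x).1, z + (L.symm x).2) = A z + x := by
      rw [hL, map_add]
      conv_rhs => rw [hx]
      simp only
      abel
    simp only [Set.mem_preimage, hK', h2, Set.mem_image]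
    constructor
    · rintro ⟨w, hw, hwz⟩
      rwa [← hwz, sub_add_cancel]
    · intro h
      exact ⟨_, h, by simp⟩
  rw [e0, e1]
  convert key using 4
  have : (n : ℝ) = Module.finrank ℝ Y + i := by exact_mod_cast hdim.symm
  rw [this]

lemma lintegral_norm_polar {E : Type*} [NormedAddCommGroup E] [NormedSpace ℝ E] [MeasurableSpace E]
    [Nontrivial E] (μ : Measure E) [FiniteDimensional ℝ E] [BorelSpace E] [μ.IsAddHaarMeasure]
    (f : ℝ → ℝ≥0∞) (hf : Measurable f) :
    ∫⁻ x, f ‖x‖ ∂μ = μ.toSphere Set.univ *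
      ∫⁻ r in Set.Ioi (0:ℝ), ENNReal.ofReal (r ^ (Module.finrank ℝ E - 1)) * f r := by
  have h1 : ∫⁻ x, f ‖x‖ ∂μ = ∫⁻ x : ({(0)}ᶜ : Set E), f (‖x.1‖) ∂(μ.comap (↑)) := by
    rw [lintegral_subtype_comap (measurableSet_singleton _).compl (fun x : E => f ‖x‖),
      restrict_compl_singleton]
  have h2 : ∫⁻ x : ({(0)}ᶜ : Set E), f (‖x.1‖) ∂(μ.comap (↑)) =
      ∫⁻ x, f x.2 ∂μ.toSphere.prod (.volumeIoiPow (Module.finrank ℝ E - 1)) := by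
    simpa using μ.measurePreserving_homeomorphUnitSphereProd.lintegral_comp
        (f := fun p => f p.2) (by fun_prop)
  rw [h1, h2, lintegral_prod _ (by fun_prop)]
  simp only [lintegral_const]
  rw [mul_comm, Measure.volumeIoiPow, lintegral_withDensity_eq_lintegral_mul _ (by fun_prop) (by fun_prop),
    ← lintegral_subtype_comap measurableSet_Ioi]
  rfl

/-- The orthogonal group. -/
abbrev OrthGrp (V : Type*) [NormedAddCommGroup V] [InnerProductSpace ℝ V] [CompleteSpace V] :=
  ↥(unitary (V →L[ℝ] V))

instance orthGrp_compact (V : Type*) [NormedAddCommGroup V] [InnerProductSpace ℝ V]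
    [CompleteSpace V] [FiniteDimensional ℝ V] [Nontrivial V] : CompactSpace (OrthGrp V) := by
  haveI : ProperSpace (V →L[ℝ] V) := FiniteDimensional.proper ℝ _
  refine isCompact_iff_compactSpace.1
    ((isCompact_closedBall (0 : V →L[ℝ] V) 1).of_isClosed_subset isClosed_unitary ?_)
  intro u hu
  rw [mem_closedBall_zero_iff]
  exact (CStarRing.norm_of_mem_unitary hu).le

set_option maxHeartbeats 800000 in
lemma avg_formula {V Z : Type} [NormedAddCommGroup V] [InnerProductSpace ℝ V] [CompleteSpace V]
    [FiniteDimensional ℝ V] [Nontrivial V] [MeasurableSpace V] [BorelSpace V]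
    [NormedAddCommGroup Z] [InnerProductSpace ℝ Z]
    [FiniteDimensional ℝ Z] [Nontrivial Z] [MeasurableSpace Z] [BorelSpace Z]
    {k i : ℕ} (hi : 1 ≤ i) (hik : i ≤ k) (hk : Module.finrank ℝ V = k)
    (hiZ : Module.finrank ℝ Z = i) (μ : Measure V) [μ.IsAddHaarMeasure]
    (hinv : ∀ e : V ≃ₗᵢ[ℝ] V, MeasurePreserving e μ μ) (J : Z →ₗᵢ[ℝ] V) :
    ∃ (G : Type) (_ : MeasurableSpace G) (γ : Measure G) (_ : IsProbabilityMeasure γ)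
      (a : G → Z →ₗᵢ[ℝ] V) (c : ℝ≥0∞), c ≠ ⊤ ∧
      ∀ f : V → ℝ≥0∞, Measurable f →
      ∫⁻ y, f y * ENNReal.ofReal (‖y‖ ^ ((i : ℝ) - k)) ∂μ = c * ∫⁻ g, (∫⁻ z, f (a g z)) ∂γ := by
  letI : MeasurableSpace (OrthGrp V) := borel (OrthGrp V)
  haveI : BorelSpace (OrthGrp V) := ⟨rfl⟩
  let γ : Measure (OrthGrp V) := Measure.haarMeasure ⊤
  haveI hγ : IsProbabilityMeasure γ := ⟨Measure.haarMeasure_self⟩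
  have hact : Measurable fun p : OrthGrp V × V => ((p.1⁻¹ : OrthGrp V) : V →L[ℝ] V) p.2 := by
    apply Continuous.measurable
    have : Continuous fun p : OrthGrp V × V => ((p.1⁻¹ : OrthGrp V) : V →L[ℝ] V) :=
      continuous_subtype_val.comp (continuous_inv.comp continuous_fst)
    exact this.clm_apply continuous_snd
  have hnorm : ∀ (g : OrthGrp V) (v : V), ‖(g : V →L[ℝ] V) v‖ = ‖v‖ := fun g v =>
    (Unitary.linearIsometryEquiv g).norm_map v
  have htrans : ∀ v w : V, ‖v‖ = ‖w‖ → ∃ g : OrthGrp V, (g : V →L[ℝ] V) v = w := by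
    intro v w h
    refine ⟨Unitary.linearIsometryEquiv.symm ((ℝ ∙ (v - w))ᗮ.reflection), ?_⟩
    exact Submodule.reflection_sub h
  have hmp : ∀ g : OrthGrp V, MeasurePreserving (g : V →L[ℝ] V) μ μ := fun g =>
    hinv (Unitary.linearIsometryEquiv g)
  refine ⟨OrthGrp V, inferInstance, γ, hγ, fun g => (Unitary.linearIsometryEquiv g⁻¹).toLinearIsometry.comp J,
    μ.toSphere Set.univ * ((volume : Measure Z).toSphere Set.univ)⁻¹, ?_, ?_⟩
  · refine ENNReal.mul_ne_top (measure_ne_top _ _) (ENNReal.inv_ne_top.2 ?_)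
    rw [Ne, Measure.measure_univ_eq_zero]
    exact Measure.toSphere_ne_zero _
  intro f hf
  have hsec : ∀ y : V, Measurable fun g : OrthGrp V => f (((g⁻¹ : OrthGrp V) : V →L[ℝ] V) y) := by
    intro y
    have hp : Measurable fun g : OrthGrp V => (g, y) := measurable_id.prodMk measurable_const
    have := (hf.comp hact).comp hp
    exact this
  let M : V → ℝ≥0∞ := fun v => ∫⁻ g, f (((g⁻¹ : OrthGrp V) : V →L[ℝ] V) v) ∂γ
  have hMm : Measurable M := (hf.comp hact).lintegral_prod_left'
  have hM : ∀ v w, ‖v‖ = ‖w‖ → M v = M w := by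
    intro v w h
    obtain ⟨g₀, hg₀⟩ := htrans v w h
    simp only [M]
    rw [← hg₀, ← lintegral_mul_left_eq_self (μ := γ)
      (fun g : OrthGrp V => f (((g⁻¹ : OrthGrp V) : V →L[ℝ] V) ((g₀ : V →L[ℝ] V) v))) g₀]
    congr 1
    ext g
    rw [← ContinuousLinearMap.mul_apply, ← Submonoid.coe_mul]
    simp
  obtain ⟨e, he⟩ := exists_norm_eq V (zero_le_one (α := ℝ))
  let m : ℝ → ℝ≥0∞ := fun r => M (r • e)
  have hm : Measurable m := hMm.comp (by fun_prop)
  have hMm' : ∀ v, M v = m ‖v‖ := fun v => hM _ _ (by simp [norm_smul, he])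
  let w : ℝ → ℝ≥0∞ := fun r => ENNReal.ofReal (r ^ ((i : ℝ) - k))
  have hw : Measurable w := by fun_prop
  have step1 : ∫⁻ y, f y * w ‖y‖ ∂μ = ∫⁻ y, m ‖y‖ * w ‖y‖ ∂μ := by
    calc ∫⁻ y, f y * w ‖y‖ ∂μ = ∫⁻ g : OrthGrp V, (∫⁻ y, f y * w ‖y‖ ∂μ) ∂γ := by simp
      _ = ∫⁻ g : OrthGrp V, (∫⁻ y, f (((g⁻¹ : OrthGrp V) : V →L[ℝ] V) y) * w ‖y‖ ∂μ) ∂γ := by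
        refine lintegral_congr fun g => ?_
        rw [← (hmp g⁻¹).lintegral_comp (by fun_prop)]
        simp_rw [hnorm]
      _ = ∫⁻ y, (∫⁻ g : OrthGrp V, f (((g⁻¹ : OrthGrp V) : V →L[ℝ] V) y) * w ‖y‖ ∂γ) ∂μ := by
        apply lintegral_lintegral_swap
        exact ((hf.comp hact).mul (by fun_prop)).aemeasurable
      _ = _ := by
        refine lintegral_congr fun y => ?_
        rw [lintegral_mul_const _ (hsec y), ← hMm']
  have step2 : ∫⁻ g : OrthGrp V, (∫⁻ z : Z, f (((g⁻¹ : OrthGrp V) : V →L[ℝ] V) (J z))) ∂γ =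
      ∫⁻ z : Z, m ‖z‖ := by
    have hJ : Measurable fun p : OrthGrp V × Z => ((p.1, J p.2) : OrthGrp V × V) :=
      measurable_fst.prodMk (J.continuous.measurable.comp measurable_snd)
    have hmeas : Measurable fun p : OrthGrp V × Z => f (((p.1⁻¹ : OrthGrp V) : V →L[ℝ] V) (J p.2)) := by
      have h2 := hf.comp (hact.comp hJ)
      simp only [Function.comp_def] at h2
      exact h2
    have sw := lintegral_lintegral_swap (μ := γ) (ν := (volume : Measure Z))
      (f := fun g z => f (((g⁻¹ : OrthGrp V) : V →L[ℝ] V) (J z))) hmeas.aemeasurable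
    rw [sw]
    refine lintegral_congr fun z => ?_
    rw [← J.norm_map z, ← hMm']
  have step3 : ∫⁻ y, f y * w ‖y‖ ∂μ = μ.toSphere Set.univ * ((volume : Measure Z).toSphere Set.univ)⁻¹ *
      ∫⁻ g : OrthGrp V, (∫⁻ z : Z, f (((g⁻¹ : OrthGrp V) : V →L[ℝ] V) (J z))) ∂γ := ?_
  · exact step3
  rw [step2]
  rw [step1, lintegral_norm_polar μ (fun r => m r * w r) (by fun_prop),
    lintegral_norm_polar (volume : Measure Z) m hm]
  have hs0 : (volume : Measure Z).toSphere Set.univ ≠ 0 := by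
    rw [Ne, Measure.measure_univ_eq_zero]
    exact Measure.toSphere_ne_zero _
  rw [mul_assoc, ← mul_assoc _⁻¹, ENNReal.inv_mul_cancel hs0 (measure_ne_top _ _), one_mul]
  congr 1
  refine setLIntegral_congr_fun measurableSet_Ioi fun r hr => ?_
  have hr : 0 < r := hr
  simp only [hk, hiZ, w]
  rw [mul_comm (m r), ← mul_assoc, ← ENNReal.ofReal_mul (by positivity)]
  congr 2
  rw [← Real.rpow_natCast, ← Real.rpow_natCast, ← Real.rpow_add hr]
  congr 1
  rw [Nat.cast_sub (by omega), Nat.cast_sub (by omega)]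
  ring

open MeasureTheory
open scoped ENNReal Pointwise

lemma exists_isometry_le {i k : ℕ} (hik : i ≤ k) :
    Nonempty (EuclideanSpace ℝ (Fin i) →ₗᵢ[ℝ] EuclideanSpace ℝ (Fin k)) := by
  let b := (EuclideanSpace.basisFun (Fin k) ℝ)
  let c := (EuclideanSpace.basisFun (Fin i) ℝ)
  have h : Orthonormal ℝ (b ∘ Fin.castLE hik) :=
    b.orthonormal.comp _ (Fin.castLE_injective hik)
  have e : (⇑(c.toBasis.constr ℝ (b ∘ Fin.castLE hik)) ∘ ⇑c.toBasis) = b ∘ Fin.castLE hik := by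
    funext j
    exact Module.Basis.constr_basis _ _ _ _
  have hc : Orthonormal ℝ ⇑c.toBasis := by
    rw [OrthonormalBasis.coe_toBasis]
    exact c.orthonormal
  exact ⟨LinearMap.isometryOfOrthonormal (c.toBasis.constr ℝ (b ∘ Fin.castLE hik)) hc
    (by rw [e]; exact h)⟩

lemma section_integral {n k : ℕ} (ι : EuclideanSpace ℝ (Fin k) →ₗᵢ[ℝ] EuclideanSpace ℝ (Fin n))
    (E : Submodule ℝ (EuclideanSpace ℝ (Fin n))) (hE : Set.range ι = (E : Set _))
    (S : Set (EuclideanSpace ℝ (Fin n))) (hS : MeasurableSet S) (p : ℝ) :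
    ∫ y in S ∩ (E : Set _), ‖y‖ ^ p ∂μH[(k : ℝ)] =
      (∫⁻ v, (ι ⁻¹' S).indicator 1 v * ENNReal.ofReal (‖v‖ ^ p) ∂μH[(k : ℝ)]).toReal := by
  have hmap := ι.isometry.map_hausdorffMeasure (d := (k : ℝ)) (Or.inl (by positivity))
  have hιS : MeasurableSet (ι ⁻¹' S) := ι.continuous.measurable hS
  rw [← Measure.restrict_restrict hS, ← hE, ← hmap,
    ι.isometry.isClosedEmbedding.measurableEmbedding.setIntegral_map,
    integral_eq_lintegral_of_nonneg_ae]
  · congr 1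
    rw [← lintegral_indicator hιS]
    refine lintegral_congr fun v => ?_
    by_cases hv : v ∈ ι ⁻¹' S
    · simp only [Set.indicator_of_mem hv, ι.norm_map, Pi.one_apply, one_mul]
    · simp only [Set.indicator_of_notMem hv, zero_mul]
  · filter_upwards with v
    positivity
  · apply Measurable.aestronglyMeasurable
    have : Measurable ι := ι.continuous.measurable
    fun_prop

theorem dual_volume_section_ineq (n k i : ℕ) (hi : 1 ≤ i) (hik : i ≤ k) (hkn : k < n)
    (K : Set (EuclideanSpace ℝ (Fin n)))
    (hKconv : Convex ℝ K) (hKcomp : IsCompact K) (hKint : (interior K).Nonempty)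
    (hcentroid : (∫ x in K, x) = 0)
    (E : Submodule ℝ (EuclideanSpace ℝ (Fin n))) (hE : Module.finrank ℝ E = k) :
    ∀ x ∈ K,
      (((i : ℝ) + 1) / ((n : ℝ) + 1)) ^ i *
          ((i : ℝ) / (k : ℝ) *
            ∫ y in (fun z => z - x) '' K ∩ (E : Set _), ‖y‖ ^ ((i : ℝ) - k) ∂μH[(k : ℝ)]) ≤
        (i : ℝ) / (k : ℝ) * ∫ y in K ∩ (E : Set _), ‖y‖ ^ ((i : ℝ) - k) ∂μH[(k : ℝ)] := by
  intro x _
  haveI : Nonempty (Fin k) := ⟨⟨0, by omega⟩⟩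
  haveI : Nonempty (Fin i) := ⟨⟨0, by omega⟩⟩
  let e : EuclideanSpace ℝ (Fin k) ≃ₗᵢ[ℝ] E :=
    ((stdOrthonormalBasis ℝ E).reindex (finCongr hE)).repr.symm
  let ι : EuclideanSpace ℝ (Fin k) →ₗᵢ[ℝ] EuclideanSpace ℝ (Fin n) :=
    E.subtypeₗᵢ.comp e.toLinearIsometry
  have hι : Set.range ι = (E : Set _) := by
    ext w
    constructor
    · rintro ⟨v, rfl⟩
      exact (e v).2
    · intro hw
      exact ⟨e.symm ⟨w, hw⟩, by simp [ι]⟩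
  clear_value ι
  have hT : IsCompact ((fun z => z - x) '' K) := hKcomp.image (by fun_prop)
  rw [section_integral ι E hι _ hT.measurableSet, section_integral ι E hι K hKcomp.measurableSet]
  haveI hH : (μH[(k : ℝ)] : Measure (EuclideanSpace ℝ (Fin k))).IsAddHaarMeasure := by
    have := isAddHaarMeasure_hausdorffMeasure (E := EuclideanSpace ℝ (Fin k))
    simpa using this
  obtain ⟨J⟩ := exists_isometry_le hik
  obtain ⟨G, _, γ, _, a, c, hc, hform⟩ := avg_formula hi hik (by simp) (by simp)
    (μH[(k : ℝ)] : Measure (EuclideanSpace ℝ (Fin k)))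
    (fun e => e.toIsometryEquiv.measurePreserving_hausdorffMeasure _) J
  have hind : ∀ S : Set (EuclideanSpace ℝ (Fin n)), MeasurableSet S →
      ∫⁻ v, (ι ⁻¹' S).indicator 1 v * ENNReal.ofReal (‖v‖ ^ ((i : ℝ) - k)) ∂μH[(k : ℝ)] =
      c * ∫⁻ g, volume ((ι.comp (a g)).toLinearMap ⁻¹' S) ∂γ := by
    intro S hS
    have hιS : MeasurableSet (ι ⁻¹' S) := ι.continuous.measurable hS
    rw [hform _ (measurable_one.indicator hιS)]
    congr 1
    refine lintegral_congr fun g => ?_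
    have h2 : MeasurableSet ((a g) ⁻¹' (ι ⁻¹' S)) := (a g).continuous.measurable hιS
    exact lintegral_indicator_one h2
  rw [hind _ hT.measurableSet, hind _ hKcomp.measurableSet]
  have hinj : ∀ g, Function.Injective (ι.comp (a g)).toLinearMap := fun g => (ι.comp (a g)).injective
  set r : ℝ := (((i : ℝ) + 1) / ((n : ℝ) + 1)) ^ i with hr
  have hr0 : 0 ≤ r := by positivity
  have hfin : c * ∫⁻ g, volume ((ι.comp (a g)).toLinearMap ⁻¹' K) ∂γ ≠ ⊤ := by
    refine ENNReal.mul_ne_top hc ?_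
    obtain ⟨R, hR⟩ := hKcomp.isBounded.subset_closedBall 0
    have hle : ∫⁻ g, volume ((ι.comp (a g)).toLinearMap ⁻¹' K) ∂γ ≤
        ∫⁻ g, volume (Metric.closedBall (0 : EuclideanSpace ℝ (Fin i)) R) ∂γ := by
      refine lintegral_mono fun g => measure_mono fun z hz => ?_
      have h3 := hR hz
      rw [mem_closedBall_zero_iff] at h3 ⊢
      rwa [← (ι.comp (a g)).norm_map z]
    refine ne_top_of_le_ne_top ?_ hle
    simpa using (measure_closedBall_lt_top (x := (0 : EuclideanSpace ℝ (Fin i))) (r := R)).ne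
  have hmain : ENNReal.ofReal r * (c * ∫⁻ g, volume ((ι.comp (a g)).toLinearMap ⁻¹' ((fun z => z - x) '' K)) ∂γ) ≤
      c * ∫⁻ g, volume ((ι.comp (a g)).toLinearMap ⁻¹' K) ∂γ := by
    rw [mul_left_comm, ← lintegral_const_mul' _ _ ENNReal.ofReal_ne_top]
    gcongr with g
    exact fradelizi_map hi hKconv hKcomp hKint hcentroid _ (hinj g) x
  have hreal := ENNReal.toReal_mono hfin hmain
  rw [ENNReal.toReal_mul, ENNReal.toReal_ofReal hr0] at hreal
  rw [mul_left_comm]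
  gcongr
end

section
/- Let 1 ≤ i ≤ k ≤ n be integers, K ⊂ ℝⁿ a convex body with centroid at the origin, E a k-dimensional subspace, and ξ ∈ S^{n-1} ∩ E. Then Ṽ_i(K ∩ E ∩ ξ⁺) ≥ (i/(n+1))^i · Ṽ_i(K ∩ E), where the dual volumes are taken within E. -/
open MeasureTheory
open scoped RealInnerProductSpace

namespace GDV
open Set
open scoped ENNReal Pointwise

lemma bm_one_compact {a b : ℝ} (ha : 0 < a) (hb : 0 < b) {A B C : Set ℝ}
    (hA : IsCompact A) (hB : IsCompact B) (hAn : A.Nonempty) (hBn : B.Nonempty)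
    (h : ∀ x ∈ A, ∀ y ∈ B, a * x + b * y ∈ C) :
    ENNReal.ofReal a * volume A + ENNReal.ofReal b * volume B ≤ volume C := by
  obtain ⟨s, hs, hs'⟩ := hA.exists_isGreatest hAn
  obtain ⟨m, hm, hm'⟩ := hB.exists_isLeast hBn
  have h1 : ENNReal.ofReal a * volume A = volume ((fun x => x + b * m) '' (a • A)) := by
    rw [image_add_right, measure_preimage_add_right, Measure.addHaar_smul]
    simp [abs_of_pos ha]
  have h2 : ENNReal.ofReal b * volume B = volume ((fun x => x + a * s) '' (b • B)) := by
    rw [image_add_right, measure_preimage_add_right, Measure.addHaar_smul]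
    simp [abs_of_pos hb]
  have hmeas : MeasurableSet ((fun x => x + a * s) '' (b • B)) := by
    apply IsCompact.measurableSet
    exact (hB.smul b).image (by fun_prop)
  rw [h1, h2, ← measure_union₀ hmeas.nullMeasurableSet]
  · apply measure_mono
    rintro z (⟨_, ⟨x, hx, rfl⟩, rfl⟩ | ⟨_, ⟨x, hx, rfl⟩, rfl⟩)
    · exact h x hx m hm
    · have := h s hs x hx
      simpa [add_comm] using this
  · refine measure_mono_null (t := {a * s + b * m}) ?_ (by simp)
    rintro z ⟨⟨_, ⟨x, hx, rfl⟩, rfl⟩, ⟨_, ⟨y, hy, rfl⟩, hxy⟩⟩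
    have e1 := hs' hx
    have e2 := hm' hy
    simp only [smul_eq_mul, mem_singleton_iff] at hxy ⊢
    nlinarith [mul_le_mul_of_nonneg_left e1 ha.le, mul_le_mul_of_nonneg_left e2 hb.le]

lemma bm_one {a b : ℝ} (ha : 0 < a) (hb : 0 < b) {A B C : Set ℝ}
    (hA : MeasurableSet A) (hB : MeasurableSet B) (hAn : A.Nonempty) (hBn : B.Nonempty)
    (h : ∀ x ∈ A, ∀ y ∈ B, a * x + b * y ∈ C) :
    ENNReal.ofReal a * volume A + ENNReal.ofReal b * volume B ≤ volume C := by
  obtain ⟨x0, hx0⟩ := hAn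
  obtain ⟨y0, hy0⟩ := hBn
  rw [hA.measure_eq_iSup_isCompact, hB.measure_eq_iSup_isCompact]
  simp only [iSup_and', ENNReal.mul_iSup]
  refine ENNReal.biSup_add_biSup_le' ⟨∅, by simp⟩ ⟨∅, by simp⟩ ?_
  rintro K1 ⟨h1, h1'⟩ K2 ⟨h2, h2'⟩
  calc _ ≤ ENNReal.ofReal a * volume (insert x0 K1) + ENNReal.ofReal b * volume (insert y0 K2) := by
        gcongr <;> simp
    _ ≤ _ := by
        apply bm_one_compact ha hb (h1'.insert x0) (h2'.insert y0) (by simp) (by simp)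
        intro x hx y hy
        apply h x (insert_subset hx0 h1 hx) y (insert_subset hy0 h2 hy)

lemma ennreal_amgm {a b : ℝ} (ha : 0 < a) (hb : 0 < b) (hab : a + b = 1) (x y : ℝ≥0∞) :
    x ^ a * y ^ b ≤ ENNReal.ofReal a * x + ENNReal.ofReal b * y := by
  rcases eq_or_ne x ⊤ with rfl | hx
  · have : ENNReal.ofReal a * ⊤ = ⊤ := ENNReal.mul_top (by simpa using ha)
    simp [this]
  rcases eq_or_ne y ⊤ with rfl | hy
  · have : ENNReal.ofReal b * ⊤ = ⊤ := ENNReal.mul_top (by simpa using hb)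
    simp [this]
  lift x to NNReal using hx
  lift y to NNReal using hy
  have := Real.geom_mean_le_arith_mean2_weighted ha.le hb.le x.2 y.2 hab
  rw [← ENNReal.ofReal_coe_nnreal, ← ENNReal.ofReal_coe_nnreal,
    ENNReal.ofReal_rpow_of_nonneg x.coe_nonneg ha.le,
    ENNReal.ofReal_rpow_of_nonneg y.coe_nonneg hb.le,
    ← ENNReal.ofReal_mul (by positivity), ← ENNReal.ofReal_mul (by positivity),
    ← ENNReal.ofReal_mul (by positivity), ← ENNReal.ofReal_add (by positivity) (by positivity)]
  exact ENNReal.ofReal_le_ofReal this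

lemma lint_layer {f : ℝ → ℝ≥0∞} (hf : Measurable f) (h1 : ∀ x, f x ≤ 1) :
    ∫⁻ x, f x = ∫⁻ t in Ioo (0 : ℝ) 1, volume {x | ENNReal.ofReal t < f x} := by
  have hne : ∀ x, f x ≠ ⊤ := fun x => ne_top_of_le_ne_top ENNReal.one_ne_top (h1 x)
  have e := lintegral_eq_lintegral_meas_lt (volume : Measure ℝ) (f := fun x => (f x).toReal)
    (Filter.Eventually.of_forall fun x => ENNReal.toReal_nonneg) hf.ennreal_toReal.aemeasurable
  simp only [ENNReal.ofReal_toReal (hne _)] at e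
  rw [e]
  have : (Ioi (0:ℝ)) = Ioo 0 1 ∪ Ici 1 := by
    rw [Ioo_union_Ici_eq_Ioi one_pos]
  rw [this, lintegral_union measurableSet_Ici]
  · have z : ∫⁻ t in Ici (1:ℝ), volume {x | t < (f x).toReal} = 0 := by
      rw [setLIntegral_congr_fun (g := fun _ => 0) measurableSet_Ici]
      · simp
      · intro t ht
        simp only
        convert measure_empty (μ := (volume : Measure ℝ))
        ext x
        simp only [mem_ofPred_eq, mem_empty_iff_false, iff_false, not_lt]
        refine le_trans ?_ ht
        exact ENNReal.toReal_le_of_le_ofReal zero_le_one (by simpa using h1 x)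
    rw [z, add_zero]
    apply setLIntegral_congr_fun measurableSet_Ioo
    intro t ht
    simp only
    congr 1
    ext x
    exact (ENNReal.ofReal_lt_iff_lt_toReal ht.1.le (hne x)).symm
  · rw [Set.disjoint_left]
    rintro x ⟨_, h⟩ h'
    exact absurd h (not_lt.2 h')

lemma pl_one_norm {a b : ℝ} (ha : 0 < a) (hb : 0 < b) (hab : a + b = 1) {f g h : ℝ → ℝ≥0∞}
    (hf : Measurable f) (hg : Measurable g) (hh : Measurable h)
    (hf1 : ⨆ x, f x = 1) (hg1 : ⨆ x, g x = 1)
    (H : ∀ x y, f x ^ a * g y ^ b ≤ h (a * x + b * y)) :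
    (∫⁻ x, f x) ^ a * (∫⁻ x, g x) ^ b ≤ ∫⁻ x, h x := by
  have hfl : ∀ x, f x ≤ 1 := fun x => hf1 ▸ le_iSup f x
  have hgl : ∀ x, g x ≤ 1 := fun x => hg1 ▸ le_iSup g x
  refine (ennreal_amgm ha hb hab _ _).trans ?_
  calc _ ≤ ∫⁻ x, min (h x) 1 := by
        rw [lint_layer hf hfl, lint_layer hg hgl, lint_layer (hh.min measurable_const) (by simp)]
        have m1 : Measurable fun t : ℝ => volume {x | ENNReal.ofReal t < f x} := by
          apply Antitone.measurable
          intro s t hst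
          apply measure_mono
          intro x hx
          exact lt_of_le_of_lt (ENNReal.ofReal_le_ofReal hst) hx
        rw [← lintegral_const_mul' _ _ ENNReal.ofReal_ne_top,
          ← lintegral_const_mul' _ _ ENNReal.ofReal_ne_top,
          ← lintegral_add_left (by fun_prop)]
        apply setLIntegral_mono' measurableSet_Ioo
        intro t ht
        have ht1 : ENNReal.ofReal t < 1 := by
          rw [ENNReal.ofReal_lt_one]; exact ht.2
        apply bm_one ha hb (measurableSet_lt measurable_const hf) (measurableSet_lt measurable_const hg)
        · rw [← hf1] at ht1
          exact lt_iSup_iff.1 ht1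
        · rw [← hg1] at ht1
          exact lt_iSup_iff.1 ht1
        · intro x hx y hy
          simp only [mem_ofPred_eq, lt_min_iff] at *
          refine ⟨lt_of_lt_of_le ?_ (H x y), ht1⟩
          have e : ENNReal.ofReal t = ENNReal.ofReal t ^ a * ENNReal.ofReal t ^ b := by
            rw [← ENNReal.rpow_add_of_nonneg _ _ ha.le hb.le, hab, ENNReal.rpow_one]
          rw [e]
          exact ENNReal.mul_lt_mul (ENNReal.rpow_lt_rpow hx ha) (ENNReal.rpow_lt_rpow hy hb)
    _ ≤ _ := lintegral_mono fun x => min_le_left _ _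

lemma pl_one_bdd {a b : ℝ} (ha : 0 < a) (hb : 0 < b) (hab : a + b = 1) {f g h : ℝ → ℝ≥0∞}
    (hf : Measurable f) (hg : Measurable g) (hh : Measurable h)
    (hf1 : ⨆ x, f x ≠ ⊤) (hg1 : ⨆ x, g x ≠ ⊤)
    (H : ∀ x y, f x ^ a * g y ^ b ≤ h (a * x + b * y)) :
    (∫⁻ x, f x) ^ a * (∫⁻ x, g x) ^ b ≤ ∫⁻ x, h x := by
  rcases eq_or_ne (⨆ x, f x) 0 with hf0 | hf0
  · have : ∀ x, f x = 0 := by simpa using hf0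
    simp [this, ENNReal.zero_rpow_of_pos ha]
  rcases eq_or_ne (⨆ x, g x) 0 with hg0 | hg0
  · have : ∀ x, g x = 0 := by simpa using hg0
    simp [this, ENNReal.zero_rpow_of_pos hb]
  set M := ⨆ x, f x with hM
  set N := ⨆ x, g x with hN
  have hMi : M⁻¹ ≠ ⊤ := by simpa using hf0
  have hNi : N⁻¹ ≠ ⊤ := by simpa using hg0
  set c := M⁻¹ ^ a * N⁻¹ ^ b with hc
  have key := pl_one_norm ha hb hab (f := fun x => M⁻¹ * f x) (g := fun x => N⁻¹ * g x)
    (h := fun x => c * h x)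
    (by fun_prop) (by fun_prop) (by fun_prop)
    (by rw [← ENNReal.mul_iSup]; exact ENNReal.inv_mul_cancel hf0 hf1)
    (by rw [← ENNReal.mul_iSup]; exact ENNReal.inv_mul_cancel hg0 hg1)
    (by
      intro x y
      rw [ENNReal.mul_rpow_of_nonneg _ _ ha.le, ENNReal.mul_rpow_of_nonneg _ _ hb.le]
      calc _ = c * (f x ^ a * g y ^ b) := by rw [hc]; ring
        _ ≤ _ := by gcongr; exact H x y)
  rw [lintegral_const_mul _ hf, lintegral_const_mul _ hg, lintegral_const_mul _ hh,
    ENNReal.mul_rpow_of_nonneg _ _ ha.le, ENNReal.mul_rpow_of_nonneg _ _ hb.le] at key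
  have c0 : c ≠ 0 := by
    rw [hc]
    apply mul_ne_zero
    · simp [ENNReal.rpow_eq_zero_iff, hf1, hf0]
    · simp [ENNReal.rpow_eq_zero_iff, hg1, hg0]
  have ct : c ≠ ⊤ := ENNReal.mul_ne_top (ENNReal.rpow_ne_top_of_nonneg ha.le hMi)
    (ENNReal.rpow_ne_top_of_nonneg hb.le hNi)
  rw [← ENNReal.mul_le_mul_iff_right c0 ct]
  refine le_trans (le_of_eq ?_) key
  rw [hc]; ring

lemma pl_one {a b : ℝ} (ha : 0 < a) (hb : 0 < b) (hab : a + b = 1) {f g h : ℝ → ℝ≥0∞}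
    (hf : Measurable f) (hg : Measurable g) (hh : Measurable h)
    (H : ∀ x y, f x ^ a * g y ^ b ≤ h (a * x + b * y)) :
    (∫⁻ x, f x) ^ a * (∫⁻ x, g x) ^ b ≤ ∫⁻ x, h x := by
  have tr : ∀ u : ℝ → ℝ≥0∞, Measurable u → ∫⁻ x, u x = ⨆ n : ℕ, ∫⁻ x, min (u x) n := by
    intro u hu
    rw [← lintegral_iSup (fun n => hu.min measurable_const)]
    · congr 1
      ext x
      rw [← inf_iSup_eq, ENNReal.iSup_natCast, inf_top_eq]
    · intro m n hmn x
      simp only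
      gcongr
  have pw : ∀ (u : ℕ → ℝ≥0∞) (c : ℝ), 0 < c → (⨆ n, u n) ^ c = ⨆ n, (u n) ^ c := by
    intro u c hc
    exact (ENNReal.orderIsoRpow c hc).map_iSup u
  have mono : ∀ u : ℝ → ℝ≥0∞, Monotone fun n : ℕ => ∫⁻ x, min (u x) n := by
    intro u m n hmn
    simp only
    gcongr
  rw [tr f hf, tr g hg, pw _ _ ha, pw _ _ hb, ENNReal.iSup_mul]
  apply iSup_le
  intro m
  rw [ENNReal.mul_iSup]
  apply iSup_le
  intro n
  apply pl_one_bdd ha hb hab (hf.min measurable_const) (hg.min measurable_const) hh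
  · exact ne_top_of_le_ne_top (ENNReal.natCast_ne_top m) (iSup_le fun x => min_le_right _ _)
  · exact ne_top_of_le_ne_top (ENNReal.natCast_ne_top n) (iSup_le fun x => min_le_right _ _)
  · intro x y
    refine le_trans ?_ (H x y)
    gcongr <;> exact min_le_left _ _

lemma pl_pi {a b : ℝ} (ha : 0 < a) (hb : 0 < b) (hab : a + b = 1) (k : ℕ) :
    ∀ {f g h : (Fin k → ℝ) → ℝ≥0∞},
    Measurable f → Measurable g → Measurable h →
    (∀ x y, f x ^ a * g y ^ b ≤ h (a • x + b • y)) →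
    (∫⁻ x, f x) ^ a * (∫⁻ x, g x) ^ b ≤ ∫⁻ x, h x := by
  induction k with
  | zero =>
    intro f g h hf hg hh H
    rw [Measure.volume_pi_eq_dirac 0, lintegral_dirac, lintegral_dirac, lintegral_dirac]
    simpa using H 0 0
  | succ k ih =>
    intro f g h hf hg hh H
    let e := (MeasurableEquiv.piFinSuccAbove (fun _ : Fin (k+1) => ℝ) 0).symm
    have he : MeasurePreserving e :=
      (volume_preserving_piFinSuccAbove (fun _ : Fin (k+1) => ℝ) 0).symm
    have split : ∀ u : (Fin (k+1) → ℝ) → ℝ≥0∞, Measurable u →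
        ∫⁻ x, u x = ∫⁻ t : ℝ, ∫⁻ y : Fin k → ℝ, u (e (t, y)) := by
      intro u hu
      rw [← he.lintegral_comp hu, Measure.volume_eq_prod, lintegral_prod]
      exact (hu.comp e.measurable).aemeasurable
    have meas : ∀ u : (Fin (k+1) → ℝ) → ℝ≥0∞, Measurable u →
        Measurable fun t : ℝ => ∫⁻ y : Fin k → ℝ, u (e (t, y)) := by
      intro u hu
      exact Measurable.lintegral_prod_right' (hu.comp e.measurable)
    rw [split f hf, split g hg, split h hh]
    apply pl_one ha hb hab (meas f hf) (meas g hg) (meas h hh)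
    intro s t
    apply ih (hf.comp (e.measurable.comp measurable_prodMk_left))
      (hg.comp (e.measurable.comp measurable_prodMk_left))
      (hh.comp (e.measurable.comp measurable_prodMk_left))
    intro x y
    refine (H _ _).trans (le_of_eq ?_)
    congr 1
    ext j
    refine Fin.cases ?_ (fun j => ?_) j
    · simp [e, MeasurableEquiv.piFinSuccAbove]
    · simp [e, MeasurableEquiv.piFinSuccAbove]

lemma pl_set {a b : ℝ} (ha : 0 < a) (hb : 0 < b) (hab : a + b = 1) {k : ℕ}
    {A B C : Set (Fin k → ℝ)} (hA : MeasurableSet A) (hB : MeasurableSet B) (hC : MeasurableSet C)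
    (h : ∀ x ∈ A, ∀ y ∈ B, a • x + b • y ∈ C) :
    volume A ^ a * volume B ^ b ≤ volume C := by
  have := pl_pi ha hb hab k (f := A.indicator 1) (g := B.indicator 1) (h := C.indicator 1)
    (measurable_one.indicator hA) (measurable_one.indicator hB) (measurable_one.indicator hC) ?_
  · simpa [lintegral_indicator_one hA, lintegral_indicator_one hB, lintegral_indicator_one hC]
      using this
  · intro x y
    by_cases hx : x ∈ A
    · by_cases hy : y ∈ B
      · simp [hx, hy, h x hx y hy]
      · simp [hy, ENNReal.zero_rpow_of_pos hb]
    · simp [hx, ENNReal.zero_rpow_of_pos ha]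

lemma rt_pow {k : ℕ} (hk : 1 ≤ k) {x : ℝ} (hx : 0 ≤ x) : (x ^ (1 / (k:ℝ))) ^ k = x := by
  rw [one_div]
  exact Real.rpow_inv_natCast_pow hx (by omega)

lemma le_rt {k : ℕ} (hk : 1 ≤ k) {x y : ℝ} (hy : 0 ≤ y) (h : x ^ k ≤ y) :
    x ≤ y ^ (1 / (k:ℝ)) := by
  rw [← rt_pow hk hy] at h
  exact le_of_pow_le_pow_left₀ (by omega) (by positivity) h

lemma vol_smul_toReal {k : ℕ} {r : ℝ} (hr : 0 ≤ r) (A : Set (Fin k → ℝ)) :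
    (volume (r • A)).toReal = r ^ k * (volume A).toReal := by
  rw [Measure.addHaar_smul, abs_of_nonneg (pow_nonneg hr _), ENNReal.toReal_mul,
    ENNReal.toReal_ofReal (pow_nonneg hr _)]
  simp

lemma bm_aux {b : ℝ} (hb : 0 < b) {k : ℕ} (hk : 1 ≤ k)
    {B C : Set (Fin k → ℝ)} (hCf : volume C ≠ ⊤) (x : Fin k → ℝ)
    (h : ∀ y ∈ B, x + b • y ∈ C) :
    b * (volume B).toReal ^ (1 / (k:ℝ)) ≤ (volume C).toReal ^ (1 / (k:ℝ)) := by
  apply le_rt hk ENNReal.toReal_nonneg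
  rw [mul_pow, rt_pow hk ENNReal.toReal_nonneg, ← vol_smul_toReal hb.le]
  apply ENNReal.toReal_mono hCf
  have : volume (b • B) = volume ((fun y => x + y) '' (b • B)) := by
    rw [image_add_left, measure_preimage_add]
  rw [this]
  apply measure_mono
  rintro _ ⟨_, ⟨y, hy, rfl⟩, rfl⟩
  exact h y hy

lemma bm {a b : ℝ} (ha : 0 < a) (hb : 0 < b) {k : ℕ} (hk : 1 ≤ k)
    {A B C : Set (Fin k → ℝ)} (hA : MeasurableSet A) (hB : MeasurableSet B) (hC : MeasurableSet C)
    (hCf : volume C ≠ ⊤)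
    (hAn : A.Nonempty) (hBn : B.Nonempty)
    (h : ∀ x ∈ A, ∀ y ∈ B, a • x + b • y ∈ C) :
    a * (volume A).toReal ^ (1 / (k:ℝ)) + b * (volume B).toReal ^ (1 / (k:ℝ))
      ≤ (volume C).toReal ^ (1 / (k:ℝ)) := by
  obtain ⟨x0, hx0⟩ := hAn
  obtain ⟨y0, hy0⟩ := hBn
  have hk0 : (1 / (k:ℝ)) ≠ 0 := by positivity
  set p := (volume A).toReal ^ (1 / (k:ℝ)) with hp
  set q := (volume B).toReal ^ (1 / (k:ℝ)) with hq
  have hp0 : 0 ≤ p := by positivity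
  have hq0 : 0 ≤ q := by positivity
  rcases hp0.eq_or_lt with hp1 | hp1
  · rw [← hp1, mul_zero, zero_add]
    exact bm_aux hb hk hCf (a • x0) (fun y hy => h x0 hx0 y hy)
  rcases hq0.eq_or_lt with hq1 | hq1
  · rw [← hq1, mul_zero, add_zero]
    exact bm_aux ha hk hCf (b • y0) (fun x hx => by rw [add_comm]; exact h x hx y0 hy0)
  have hpk : p ^ k = (volume A).toReal := rt_pow hk ENNReal.toReal_nonneg
  have hqk : q ^ k = (volume B).toReal := rt_pow hk ENNReal.toReal_nonneg
  set D := a * p + b * q with hD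
  have hD0 : 0 < D := by positivity
  have hvA : volume (p⁻¹ • A) = 1 := by
    rw [← ENNReal.toReal_eq_one_iff, vol_smul_toReal (by positivity), ← hpk, ← mul_pow,
      inv_mul_cancel₀ hp1.ne', one_pow]
  have hvB : volume (q⁻¹ • B) = 1 := by
    rw [← ENNReal.toReal_eq_one_iff, vol_smul_toReal (by positivity), ← hqk, ← mul_pow,
      inv_mul_cancel₀ hq1.ne', one_pow]
  have key := pl_set (a := a * p / D) (b := b * q / D) (by positivity) (by positivity)
    (by rw [← add_div, ← hD, div_self hD0.ne'])
    (hA.const_smul₀ p⁻¹) (hB.const_smul₀ q⁻¹) (hC.const_smul₀ D⁻¹) ?_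
  · rw [hvA, hvB, ENNReal.one_rpow, ENNReal.one_rpow, one_mul] at key
    have hf : volume (D⁻¹ • C) ≠ ⊤ := by
      rw [Measure.addHaar_smul]
      exact ENNReal.mul_ne_top ENNReal.ofReal_ne_top hCf
    have key2 := ENNReal.toReal_mono hf key
    rw [vol_smul_toReal (by positivity), ENNReal.toReal_one, inv_pow, ← div_eq_inv_mul,
      one_le_div (by positivity)] at key2
    exact le_rt hk ENNReal.toReal_nonneg key2
  · rintro _ ⟨x, hx, rfl⟩ _ ⟨y, hy, rfl⟩
    refine ⟨a • x + b • y, h x hx y hy, ?_⟩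
    simp only [smul_add, smul_smul]
    congr 2 <;> field_simp

end GDV

namespace GDV
open Set
open scoped ENNReal Pointwise
set_option linter.unusedSectionVars false

lemma usc_fibre {Z F : Type*} [TopologicalSpace Z] [TopologicalSpace F] [MeasurableSpace F]
    [BorelSpace F] (ν : Measure F) {S : Set (Z × F)} (hS : IsClosed S) {B : Set F}
    (hB : ν B ≠ ⊤) (hSB : ∀ z w, (z, w) ∈ S → w ∈ B) {x : ℕ → Z} {x0 : Z}
    (hx : Filter.Tendsto x Filter.atTop (nhds x0)) {c : ℝ≥0∞}
    (hc : ∀ᶠ n in Filter.atTop, c ≤ ν {w | (x n, w) ∈ S}) : c ≤ ν {w | (x0, w) ∈ S} := by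
  have hm : ∀ z, MeasurableSet {w | (z, w) ∈ S} := fun z =>
    (hS.preimage (by fun_prop : Continuous fun w : F => (z, w))).measurableSet
  let T : ℕ → Set F := fun N => ⋃ n ≥ N, {w | (x n, w) ∈ S}
  have hT : Antitone T := by
    intro a b hab
    exact biUnion_subset_biUnion_left fun n hn => le_trans hab hn
  have hTm : ∀ N, MeasurableSet (T N) := fun N =>
    MeasurableSet.biUnion (to_countable _) fun n _ => hm _
  have hTB : ∀ N, T N ⊆ B := fun N => iUnion₂_subset fun n _ w hw => hSB _ _ hw
  have lim := tendsto_measure_iInter_atTop (μ := ν) (s := T)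
    (fun N => (hTm N).nullMeasurableSet) hT ⟨0, ne_top_of_le_ne_top hB (measure_mono (hTB 0))⟩
  have h1 : c ≤ ν (⋂ n, T n) := by
    refine ge_of_tendsto lim ?_
    filter_upwards [hc] with n hn
    refine hn.trans (measure_mono ?_)
    intro w hw
    exact mem_iUnion₂.2 ⟨n, le_refl _, hw⟩
  refine h1.trans (measure_mono ?_)
  intro w hw
  rw [mem_iInter] at hw
  have hfr : ∃ᶠ n in Filter.atTop, (x n, w) ∈ S := by
    rw [Filter.frequently_atTop]
    intro N
    obtain ⟨n, hn, h⟩ := mem_iUnion₂.1 (hw N)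
    exact ⟨n, hn, h⟩
  have ht : Filter.Tendsto (fun n => (x n, w)) Filter.atTop (nhds (x0, w)) :=
    hx.prodMk_nhds tendsto_const_nhds
  exact hS.mem_of_frequently_of_tendsto hfr ht

lemma low_meas {ν : Measure ℝ} [IsFiniteMeasure ν] (t : ℝ≥0∞) :
    ν {r | ν (Ici r) < t} ≤ t := by
  have hm : MeasurableSet {r | ν (Ici r) < t} := by
    have hUm : Measurable fun r => (ν (Ici r)) := by
      apply Antitone.measurable
      intro a b hab
      exact measure_mono (Ici_subset_Ici.2 hab)
    exact measurableSet_lt hUm measurable_const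
  rw [hm.measure_eq_iSup_isCompact]
  refine iSup_le fun C => iSup_le fun hC => iSup_le fun hCc => ?_
  rcases C.eq_empty_or_nonempty with rfl | hne
  · simp
  · obtain ⟨r, hr, hr'⟩ := hCc.exists_isLeast hne
    have : ν (Ici r) < t := hC hr
    exact (measure_mono (fun x hx => hr' hx)).trans this.le

lemma dist_bound {α : Type*} [MeasurableSpace α] (μ : Measure α) [IsFiniteMeasure μ]
    {ψ : α → ℝ} (hψ : Measurable ψ) {p : ℝ} (hp : 0 < p) :
    ENNReal.ofReal ((μ univ).toReal ^ (p + 1) / (p + 1)) ≤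
      ∫⁻ y, ENNReal.ofReal ((μ {w | ψ y ≤ ψ w}).toReal ^ p) ∂μ := by
  set m := (μ univ).toReal with hm
  have hm0 : 0 ≤ m := ENNReal.toReal_nonneg
  let ν := μ.map ψ
  have : IsFiniteMeasure ν := Measure.isFiniteMeasure_map _ _
  have hν : ∀ r, ν (Ici r) = μ {w | r ≤ ψ w} := fun r => by
    rw [Measure.map_apply hψ measurableSet_Ici]; rfl
  have hUm : Measurable fun r => (ν (Ici r)) := by
    apply Antitone.measurable
    intro a b hab
    exact measure_mono (Ici_subset_Ici.2 hab)
  have hU : Measurable fun y => (μ {w | ψ y ≤ ψ w}).toReal := by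
    simp_rw [← hν]
    exact (hUm.comp hψ).ennreal_toReal
  have hlow : ∀ t : ℝ, 0 < t → ENNReal.ofReal (m - t) ≤ μ {y | t ≤ (μ {w | ψ y ≤ ψ w}).toReal} := by
    intro t ht
    have h1 : μ {y | t ≤ (μ {w | ψ y ≤ ψ w}).toReal}ᶜ ≤ ENNReal.ofReal t := by
      have := low_meas (ν := ν) (ENNReal.ofReal t)
      rw [Measure.map_apply hψ (measurableSet_lt hUm measurable_const)] at this
      refine le_trans (measure_mono ?_) this
      intro y hy
      simp only [mem_compl_iff, mem_ofPred_eq, not_le, mem_preimage] at hy ⊢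
      rw [hν]
      exact (ENNReal.lt_ofReal_iff_toReal_lt (measure_ne_top _ _)).2 hy
    have hms : MeasurableSet {y | t ≤ (μ {w | ψ y ≤ ψ w}).toReal} :=
      measurableSet_le measurable_const hU
    have h2 := measure_add_measure_compl (μ := μ) hms
    rw [ENNReal.ofReal_sub _ ht.le, hm, ENNReal.ofReal_toReal (measure_ne_top _ _), ← h2]
    refine tsub_le_iff_right.2 ?_
    gcongr
  rw [lintegral_rpow_eq_lintegral_meas_le_mul μ
    (Filter.Eventually.of_forall fun _ => ENNReal.toReal_nonneg) hU.aemeasurable hp]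
  calc ENNReal.ofReal (m ^ (p + 1) / (p + 1))
      = ENNReal.ofReal (p * ∫ t in Ioc 0 m, (m - t) * t ^ (p - 1)) := by
        congr 1
        rw [← intervalIntegral.integral_of_le hm0]
        have e : ∀ t ∈ uIoc (0:ℝ) m, (m - t) * t ^ (p - 1) = m * t ^ (p - 1) - t ^ p := by
          intro t ht
          rw [uIoc_of_le hm0] at ht
          rw [sub_mul]
          congr 1
          nth_rw 1 [← Real.rpow_one t]
          rw [← Real.rpow_add ht.1]
          congr 1; ring
        rw [intervalIntegral.integral_congr_ae (Filter.Eventually.of_forall e),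
          intervalIntegral.integral_sub, intervalIntegral.integral_const_mul,
          integral_rpow (by left; linarith), integral_rpow (by left; linarith)]
        · rw [Real.zero_rpow (by linarith), Real.zero_rpow (by linarith), sub_add_cancel,
            Real.rpow_add_one' hm0 (by linarith)]
          field_simp
          ring
        · exact (intervalIntegral.intervalIntegrable_rpow' (by linarith)).const_mul _
        · exact intervalIntegral.intervalIntegrable_rpow' (by linarith)
    _ ≤ ENNReal.ofReal p * ∫⁻ t in Ioc 0 m, ENNReal.ofReal ((m - t) * t ^ (p - 1)) := by
        rw [ENNReal.ofReal_mul hp.le]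
        gcongr
        rw [integral_eq_lintegral_of_nonneg_ae]
        · exact ENNReal.ofReal_toReal_le
        · filter_upwards [ae_restrict_mem measurableSet_Ioc] with t ht
          exact mul_nonneg (sub_nonneg.2 ht.2) (Real.rpow_nonneg ht.1.le _)
        · apply Measurable.aestronglyMeasurable
          fun_prop
    _ ≤ ENNReal.ofReal p * ∫⁻ t in Ioc 0 m, μ {y | t ≤ (μ {w | ψ y ≤ ψ w}).toReal} *
          ENNReal.ofReal (t ^ (p - 1)) := by
        gcongr 1
        apply setLIntegral_mono' measurableSet_Ioc
        intro t ht
        rw [ENNReal.ofReal_mul (sub_nonneg.2 ht.2)]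
        gcongr
        exact hlow t ht.1
    _ ≤ _ := by
        gcongr
        exact Ioc_subset_Ioi_self

section core
variable {G : Type*} [NormedAddCommGroup G] [NormedSpace ℝ G] {k : ℕ}

def sec (K : Set (G × (Fin k → ℝ))) (g : G) : Set (Fin k → ℝ) := {w | (g, w) ∈ K}

def cap (K : Set (G × (Fin k → ℝ))) (ψ : (Fin k → ℝ) →L[ℝ] ℝ) (x : G × (Fin k → ℝ)) :
    Set (Fin k → ℝ) := {w | (x.1, w) ∈ K ∧ ψ x.2 ≤ ψ w}

noncomputable def ff (K : Set (G × (Fin k → ℝ))) (g : G) : ℝ :=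
  (volume (sec K g)).toReal ^ (1 / (k:ℝ))

noncomputable def Ph (K : Set (G × (Fin k → ℝ))) (ψ : (Fin k → ℝ) →L[ℝ] ℝ)
    (x : G × (Fin k → ℝ)) : ℝ :=
  (volume (cap K ψ x)).toReal ^ (1 / (k:ℝ))

variable {K : Set (G × (Fin k → ℝ))}

lemma sec_closed (hK : IsCompact K) (g : G) : IsClosed (sec K g) :=
  hK.isClosed.preimage (by fun_prop : Continuous fun w : Fin k → ℝ => (g, w))

lemma sec_sub  (g : G) : sec K g ⊆ Prod.snd '' K := fun w hw => ⟨(g, w), hw, rfl⟩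

lemma vol_fin (hK : IsCompact K) : volume (Prod.snd '' K) ≠ ⊤ := (hK.image continuous_snd).measure_lt_top.ne

lemma sec_fin (hK : IsCompact K) (g : G) : volume (sec K g) ≠ ⊤ :=
  ne_top_of_le_ne_top (vol_fin hK) (measure_mono (sec_sub g))

lemma cap_sub (ψ : (Fin k → ℝ) →L[ℝ] ℝ) (x : G × (Fin k → ℝ)) : cap K ψ x ⊆ sec K x.1 := fun _ hw => hw.1

lemma cap_fin (hK : IsCompact K) (ψ : (Fin k → ℝ) →L[ℝ] ℝ) (x : G × (Fin k → ℝ)) : volume (cap K ψ x) ≠ ⊤ :=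
  ne_top_of_le_ne_top (sec_fin hK x.1) (measure_mono (cap_sub ψ x))

lemma capS_closed (hK : IsCompact K) (ψ : (Fin k → ℝ) →L[ℝ] ℝ) : IsClosed {z : (G × (Fin k → ℝ)) × (Fin k → ℝ) |
    (z.1.1, z.2) ∈ K ∧ ψ z.1.2 ≤ ψ z.2} :=
  (hK.isClosed.preimage (by fun_prop : Continuous
    fun z : (G × (Fin k → ℝ)) × (Fin k → ℝ) => (z.1.1, z.2))).inter
    (isClosed_le (f := fun z : (G × (Fin k → ℝ)) × (Fin k → ℝ) => ψ z.1.2)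
      (g := fun z => ψ z.2) (by fun_prop) (by fun_prop))

lemma cap_closed (hK : IsCompact K) (ψ : (Fin k → ℝ) →L[ℝ] ℝ) (x : G × (Fin k → ℝ)) : IsClosed (cap K ψ x) :=
  (capS_closed hK ψ).preimage (by fun_prop : Continuous fun w : Fin k → ℝ => (x, w))

lemma ff_conc (hK : IsCompact K) (hKc : Convex ℝ K) (hk : 1 ≤ k) {x y : G} (hx : (sec K x).Nonempty) (hy : (sec K y).Nonempty) {a b : ℝ}
    (ha : 0 < a) (hb : 0 < b) (hab : a + b = 1) :
    a * ff K x + b * ff K y ≤ ff K (a • x + b • y) := by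
  apply bm ha hb hk (sec_closed hK x).measurableSet (sec_closed hK y).measurableSet
    (sec_closed hK _).measurableSet (sec_fin hK _) hx hy
  intro u hu v hv
  exact hKc hu hv ha.le hb.le hab

lemma Ph_conc (hK : IsCompact K) (hKc : Convex ℝ K) (ψ : (Fin k → ℝ) →L[ℝ] ℝ) (hk : 1 ≤ k) : ConcaveOn ℝ K (Ph K ψ) := by
  rw [concaveOn_iff_forall_pos]
  refine ⟨hKc, ?_⟩
  intro x hx y hy a b ha hb hab
  apply bm ha hb hk (cap_closed hK ψ x).measurableSet (cap_closed hK ψ y).measurableSet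
    (cap_closed hK ψ _).measurableSet (cap_fin hK ψ _) ⟨x.2, hx, le_rfl⟩ ⟨y.2, hy, le_rfl⟩
  intro u hu v hv
  refine ⟨hKc hu.1 hv.1 ha.le hb.le hab, ?_⟩
  simp only [Prod.snd_add, Prod.smul_snd, map_add, map_smul, smul_eq_mul]
  have := mul_le_mul_of_nonneg_left hu.2 ha.le
  have := mul_le_mul_of_nonneg_left hv.2 hb.le
  linarith

lemma hyp_closed (hK : IsCompact K) (ψ : (Fin k → ℝ) →L[ℝ] ℝ) (hk : 1 ≤ k) : IsClosed {z : (G × (Fin k → ℝ)) × ℝ | z.1 ∈ K ∧ z.2 ≤ Ph K ψ z.1} := by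
  apply IsSeqClosed.isClosed
  intro z z0 hz hlim
  have l1 : Filter.Tendsto (fun n => (z n).1) Filter.atTop (nhds z0.1) :=
    (continuous_fst.tendsto _).comp hlim
  have l2 : Filter.Tendsto (fun n => (z n).2) Filter.atTop (nhds z0.2) :=
    (continuous_snd.tendsto _).comp hlim
  refine ⟨hK.isClosed.mem_of_tendsto l1 (Filter.Eventually.of_forall fun n => (hz n).1), ?_⟩
  by_contra hcon
  rw [not_le] at hcon
  obtain ⟨s, hs1, hs2⟩ := exists_between hcon
  have hP0 : 0 ≤ Ph K ψ z0.1 := by unfold Ph; positivity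
  have hs0 : 0 ≤ s := hP0.trans hs1.le
  have : ENNReal.ofReal (s ^ k) ≤ volume (cap K ψ z0.1) := by
    refine usc_fibre volume (capS_closed hK ψ) (vol_fin hK) ?_ l1 ?_
    · intro x w hw
      exact ⟨_, hw.1, rfl⟩
    · filter_upwards [l2.eventually (lt_mem_nhds hs2)] with n hn
      have h2 := hn.le.trans (hz n).2
      have h3 : s ^ k ≤ (volume (cap K ψ (z n).1)).toReal := by
        rw [← rt_pow hk (ENNReal.toReal_nonneg (a := volume (cap K ψ (z n).1)))]
        exact pow_le_pow_left₀ hs0 h2 k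
      exact ENNReal.ofReal_le_of_le_toReal h3
  have h4 : s ^ k ≤ (volume (cap K ψ z0.1)).toReal :=
    (ENNReal.ofReal_le_iff_le_toReal (cap_fin hK ψ _)).1 this
  exact absurd (le_rt hk ENNReal.toReal_nonneg h4) (not_le.2 hs1)

variable [FiniteDimensional ℝ G] [MeasurableSpace G] [BorelSpace G]

lemma ff_meas (hK : IsCompact K) : Measurable (ff K) := by
  have h : Measurable fun g => volume (sec K g) :=
    measurable_measure_prodMk_left hK.isClosed.measurableSet
  exact h.ennreal_toReal.pow_const _

lemma Ph_meas (hK : IsCompact K) (ψ : (Fin k → ℝ) →L[ℝ] ℝ) : Measurable (Ph K ψ) := by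
  have h : Measurable fun x => volume (cap K ψ x) :=
    measurable_measure_prodMk_left (capS_closed hK ψ).measurableSet
  exact h.ennreal_toReal.pow_const _

end core

end GDV

namespace GDV
open Set
open scoped ENNReal Pointwise
set_option linter.unusedSectionVars false
section core2
variable {G : Type*} [NormedAddCommGroup G] [NormedSpace ℝ G] {k : ℕ}
variable [FiniteDimensional ℝ G] [MeasurableSpace G] [BorelSpace G]
variable {K : Set (G × (Fin k → ℝ))}

lemma ff_nonneg (g : G) : 0 ≤ ff K g := by unfold ff; positivity

lemma Ph_nonneg (ψ : (Fin k → ℝ) →L[ℝ] ℝ) (x : G × (Fin k → ℝ)) : 0 ≤ Ph K ψ x := by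
  unfold Ph; positivity

lemma Ph_le (hK : IsCompact K) (ψ : (Fin k → ℝ) →L[ℝ] ℝ) (x : G × (Fin k → ℝ)) :
    Ph K ψ x ≤ (volume (Prod.snd '' K)).toReal ^ (1 / (k:ℝ)) := by
  unfold Ph
  apply Real.rpow_le_rpow ENNReal.toReal_nonneg _ (by positivity)
  exact ENNReal.toReal_mono (vol_fin hK) (measure_mono ((cap_sub ψ x).trans (sec_sub _)))

lemma ff_le (hK : IsCompact K) (g : G) :
    ff K g ≤ (volume (Prod.snd '' K)).toReal ^ (1 / (k:ℝ)) := by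
  unfold ff
  apply Real.rpow_le_rpow ENNReal.toReal_nonneg _ (by positivity)
  exact ENNReal.toReal_mono (vol_fin hK) (measure_mono (sec_sub _))

lemma ff_zero (hk : 1 ≤ k) {g : G} (h : ¬ (sec K g).Nonempty) : ff K g = 0 := by
  rw [not_nonempty_iff_eq_empty] at h
  have : (1 / (k:ℝ)) ≠ 0 := by positivity
  simp only [ff, h, measure_empty, ENNReal.toReal_zero]
  exact Real.zero_rpow this

variable (μ : Measure G) [μ.IsAddHaarMeasure]

lemma Ph_int (hK : IsCompact K) (ψ : (Fin k → ℝ) →L[ℝ] ℝ) :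
    IntegrableOn (Ph K ψ) K (μ.prod volume) := by
  apply Measure.integrableOn_of_bounded hK.measure_lt_top.ne
    (Ph_meas hK ψ).aestronglyMeasurable (M := (volume (Prod.snd '' K)).toReal ^ (1 / (k:ℝ)))
  refine Filter.Eventually.of_forall fun x => ?_
  rw [Real.norm_of_nonneg (Ph_nonneg ψ x)]
  exact Ph_le hK ψ x

lemma ff_int (hK : IsCompact K) (hk : 1 ≤ k) {j : ℕ} (hj : 1 ≤ j) :
    Integrable (fun g => ff K g ^ j) μ := by
  have h1 : IntegrableOn (fun g => ff K g ^ j) (Prod.fst '' K) μ := by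
    apply Measure.integrableOn_of_bounded (hK.image continuous_fst).measure_lt_top.ne
      ((ff_meas hK).pow_const j).aestronglyMeasurable
      (M := ((volume (Prod.snd '' K)).toReal ^ (1 / (k:ℝ))) ^ j)
    refine Filter.Eventually.of_forall fun x => ?_
    rw [Real.norm_of_nonneg (pow_nonneg (ff_nonneg x) _)]
    exact pow_le_pow_left₀ (ff_nonneg x) (ff_le hK x) _
  rw [integrableOn_iff_integrable_of_support_subset] at h1
  · exact h1
  · intro g hg
    by_contra hcon
    apply hg
    change ff K g ^ j = 0
    rw [ff_zero hk, zero_pow (by omega)]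
    rintro ⟨w, hw⟩
    exact hcon ⟨(g, w), hw, rfl⟩

lemma ff_pow (hk : 1 ≤ k) (g : G) : ff K g ^ k = (volume (sec K g)).toReal :=
  rt_pow hk ENNReal.toReal_nonneg

lemma int_ff_pow (hK : IsCompact K) (hk : 1 ≤ k) :
    ∫ g, ff K g ^ k ∂μ = ((μ.prod volume) K).toReal := by
  simp_rw [ff_pow hk]
  rw [Measure.prod_apply hK.isClosed.measurableSet]
  rw [integral_toReal]
  · rfl
  · exact (measurable_measure_prodMk_left hK.isClosed.measurableSet).aemeasurable
  · exact Filter.Eventually.of_forall fun g => (sec_fin hK g).lt_top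

lemma jensen (hK : IsCompact K) (hKc : Convex ℝ K) (ψ : (Fin k → ℝ) →L[ℝ] ℝ) (hk : 1 ≤ k)
    (h0 : (μ.prod volume) K ≠ 0) (hc : ∫ x in K, x ∂(μ.prod volume) = 0) :
    (0 : G × (Fin k → ℝ)) ∈ K ∧
    ∫ x in K, Ph K ψ x ∂(μ.prod volume) ≤ Ph K ψ 0 * ((μ.prod volume) K).toReal := by
  set ρ := μ.prod (volume : Measure (Fin k → ℝ)) with hρ
  have hconv : Convex ℝ {z : (G × (Fin k → ℝ)) × ℝ | z.1 ∈ K ∧ z.2 ≤ Ph K ψ z.1} :=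
    (Ph_conc hK hKc ψ hk).convex_hypograph
  have hid : IntegrableOn (fun x : G × (Fin k → ℝ) => x) K ρ :=
    continuous_id.continuousOn.integrableOn_compact hK
  have hIntg : IntegrableOn (fun x => (x, Ph K ψ x)) K ρ := hid.prodMk (Ph_int μ hK ψ)
  have := hconv.set_average_mem (hyp_closed hK ψ hk) h0 hK.measure_lt_top.ne
    (f := fun x => (x, Ph K ψ x)) (μ := ρ) (t := K) ?_ hIntg
  · rw [setAverage_eq, integral_pair hid (Ph_int μ hK ψ), hc] at this
    simp only [Prod.smul_mk, smul_zero, mem_ofPred_eq, smul_eq_mul] at this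
    refine ⟨this.1, ?_⟩
    have hpos : 0 < ρ.real K := ENNReal.toReal_pos h0 hK.measure_lt_top.ne
    have h2 := this.2
    rw [inv_mul_le_iff₀ hpos] at h2
    rw [mul_comm]
    exact h2
  · filter_upwards [ae_restrict_mem hK.isClosed.measurableSet] with x hx
    exact ⟨hx, le_rfl⟩

lemma Ph_lower (hK : IsCompact K) (ψ : (Fin k → ℝ) →L[ℝ] ℝ) (hk : 1 ≤ k) :
    (k / (k + 1) : ℝ) * ∫ g, ff K g ^ (k + 1) ∂μ ≤ ∫ x in K, Ph K ψ x ∂(μ.prod volume) := by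
  have hKm := hK.isClosed.measurableSet
  rw [← integral_indicator hKm, integral_prod _ ((integrable_indicator_iff hKm).2 (Ph_int μ hK ψ)),
    ← integral_const_mul]
  apply integral_mono ((ff_int μ hK hk (by omega)).const_mul _)
    ((integrable_indicator_iff hKm).2 (Ph_int μ hK ψ)).integral_prod_left
  intro g
  have hsm := (sec_closed hK g).measurableSet
  have e1 : ∫ y, K.indicator (Ph K ψ) (g, y) = ∫ y in sec K g, Ph K ψ (g, y) := by
    rw [← integral_indicator hsm]
    rfl
  simp only
  rw [e1, integral_eq_lintegral_of_nonneg_ae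
    (Filter.Eventually.of_forall fun y => Ph_nonneg ψ _)
    ((Ph_meas hK ψ).comp measurable_prodMk_left).aestronglyMeasurable]
  have : IsFiniteMeasure ((volume : Measure (Fin k → ℝ)).restrict (sec K g)) :=
    ⟨by rw [Measure.restrict_apply_univ]; exact (sec_fin hK g).lt_top⟩
  have hkp : (0:ℝ) < k := by exact_mod_cast hk
  have db := dist_bound ((volume : Measure (Fin k → ℝ)).restrict (sec K g)) (ψ := ψ)
    ψ.continuous.measurable (p := 1 / (k:ℝ)) (by positivity)
  have e2 : ∀ y, ((volume : Measure (Fin k → ℝ)).restrict (sec K g)) {w | ψ y ≤ ψ w} =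
      volume (cap K ψ (g, y)) := by
    intro y
    rw [Measure.restrict_apply' hsm]
    congr 1
    ext w
    exact and_comm
  simp_rw [e2] at db
  rw [Measure.restrict_apply_univ] at db
  have e3 : (k / (k + 1) : ℝ) * ff K g ^ (k + 1) =
      (volume (sec K g)).toReal ^ (1 / (k:ℝ) + 1) / (1 / (k:ℝ) + 1) := by
    rw [pow_succ, ff_pow hk, Real.rpow_add_one' ENNReal.toReal_nonneg (by positivity)]
    unfold ff
    field_simp
    ring
  rw [e3]
  have hfin : ∫⁻ y in sec K g, ENNReal.ofReal (Ph K ψ (g, y)) ≠ ⊤ := by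
    refine ne_top_of_le_ne_top ?_ (lintegral_mono fun y => ENNReal.ofReal_le_ofReal (Ph_le hK ψ _))
    rw [lintegral_const, Measure.restrict_apply_univ]
    exact ENNReal.mul_ne_top ENNReal.ofReal_ne_top (sec_fin hK g)
  exact (ENNReal.ofReal_le_iff_le_toReal hfin).1 db

lemma ray (hK : IsCompact K) (hKc : Convex ℝ K) (hk : 1 ≤ k)
    (h0 : (sec K (0 : G)).Nonempty) :
    ((k:ℝ) + 1) * ff K 0 * ∫ g, ff K g ^ k ∂μ ≤
      (((Module.finrank ℝ G + k : ℕ) : ℝ) + 1) * ∫ g, ff K g ^ (k + 1) ∂μ := by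
  set d := Module.finrank ℝ G with hd
  set c := ff K (0 : G) with hc
  set A := ∫ g, ff K g ^ (k + 1) ∂μ with hA
  set B := ∫ g, ff K g ^ k ∂μ with hB
  have hc0 : 0 ≤ c := ff_nonneg _
  have iA := ff_int μ hK hk (j := k + 1) (by omega)
  have iB := ff_int μ hK hk (j := k) hk
  have step : ∀ s : ℝ, 0 < s → s < 1 →
      s ^ (d + k) * ((k:ℝ) + 1) * c * B ≤ (∑ i ∈ Finset.range (d + k + 1), s ^ i) * A := by
    intro s hs0 hs1
    have pt : ∀ g, s ^ (k + 1) * ff K g ^ (k + 1) + ((k + 1) * (1 - s) * c * s ^ k) * ff K g ^ k ≤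
        ff K (s • g) ^ (k + 1) := by
      intro g
      by_cases hg : (sec K g).Nonempty
      · have h1 := ff_conc hK hKc hk h0 hg (a := 1 - s) (b := s) (by linarith) hs0 (by ring)
        rw [smul_zero, zero_add] at h1
        have hf0 : 0 ≤ ff K g := ff_nonneg g
        have h2 : 0 ≤ (1 - s) * c := mul_nonneg (by linarith) hc0
        refine le_trans ?_ (pow_le_pow_left₀ (by positivity) h1 (k + 1))
        have h3 := pow_add_mul_le_add_pow (a := s * ff K g) (b := (1 - s) * c) (by positivity)
          (by positivity) (k + 1)
        simp only [Nat.add_sub_cancel, Nat.cast_add, Nat.cast_one] at h3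
        calc _ = (s * ff K g) ^ (k + 1) + (k + 1) * (s * ff K g) ^ k * ((1 - s) * c) := by
              rw [mul_pow, mul_pow]; ring
          _ ≤ _ := h3
          _ = _ := by rw [add_comm]
      · rw [ff_zero hk hg, zero_pow (by omega), zero_pow (by omega)]
        have := ff_nonneg (K := K) (s • g)
        simp only [mul_zero, add_zero]
        positivity
    have hcs := Measure.integral_comp_smul μ (fun g => ff K g ^ (k + 1)) s
    rw [← hd, ← hA, abs_of_pos (by positivity), smul_eq_mul] at hcs
    have icomp : Integrable (fun g => ff K (s • g) ^ (k + 1)) μ := iA.comp_smul hs0.ne'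
    have hm := integral_mono ((iA.const_mul _).add (iB.const_mul _)) icomp pt
    simp only [Pi.add_apply] at hm
    rw [integral_add (iA.const_mul _) (iB.const_mul _), integral_const_mul, integral_const_mul, hcs,
      ← hA, ← hB, le_inv_mul_iff₀ (by positivity)] at hm
    have hg := geom_sum_mul_neg s (d + k + 1)
    have h1s : 0 < 1 - s := by linarith
    rw [← mul_le_mul_iff_left₀ h1s]
    have : (∑ i ∈ Finset.range (d + k + 1), s ^ i) * A * (1 - s) = (1 - s ^ (d + k + 1)) * A := by
      rw [← hg]; ring
    rw [this]
    have e : s ^ d * (s ^ (k + 1) * A + (k + 1) * (1 - s) * c * s ^ k * B) =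
      s ^ (d + k + 1) * A + s ^ (d + k) * (k + 1) * c * B * (1 - s) := by ring
    rw [e] at hm
    linarith
  have l1 : Filter.Tendsto (fun s : ℝ => s ^ (d + k) * ((k:ℝ) + 1) * c * B) (nhdsWithin 1 (Iio 1))
      (nhds (1 ^ (d + k) * ((k:ℝ) + 1) * c * B)) :=
    (Continuous.tendsto (by fun_prop) 1).mono_left nhdsWithin_le_nhds
  have l2 : Filter.Tendsto (fun s : ℝ => (∑ i ∈ Finset.range (d + k + 1), s ^ i) * A)
      (nhdsWithin 1 (Iio 1)) (nhds ((∑ i ∈ Finset.range (d + k + 1), (1:ℝ) ^ i) * A)) :=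
    (Continuous.tendsto (by fun_prop) 1).mono_left nhdsWithin_le_nhds
  have := le_of_tendsto_of_tendsto l1 l2 (by
    filter_upwards [Ioo_mem_nhdsLT (zero_lt_one (α := ℝ))] with s hs
    exact step s hs.1 hs.2)
  simpa using this

lemma core (hK : IsCompact K) (hKc : Convex ℝ K) (ψ : (Fin k → ℝ) →L[ℝ] ℝ) (hk : 1 ≤ k)
    (h0 : (μ.prod volume) K ≠ 0) (hc : ∫ x in K, x ∂(μ.prod volume) = 0) :
    ENNReal.ofReal (((k:ℝ) / (((Module.finrank ℝ G + k : ℕ) : ℝ) + 1)) ^ k) *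
      volume {w : Fin k → ℝ | ((0:G), w) ∈ K} ≤
      volume {w : Fin k → ℝ | ((0:G), w) ∈ K ∧ 0 ≤ ψ w} := by
  obtain ⟨hz, hj⟩ := jensen μ hK hKc ψ hk h0 hc
  have hlow := Ph_lower μ hK ψ hk
  have hray := ray μ hK hKc hk ⟨0, hz⟩
  rw [int_ff_pow μ hK hk] at hray
  set R := ((μ.prod volume) K).toReal with hR
  have hRpos : 0 < R := ENNReal.toReal_pos h0 hK.measure_lt_top.ne
  set N : ℝ := ((Module.finrank ℝ G + k : ℕ) : ℝ) with hN
  have hN0 : 0 ≤ N := by positivity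
  set A := ∫ g, ff K g ^ (k + 1) ∂μ with hA
  have h1 : (k:ℝ) / (N + 1) * ff K 0 ≤ Ph K ψ 0 := by
    have hkp : (0:ℝ) < k := by exact_mod_cast hk
    have h2 : (k / (k + 1) : ℝ) * A ≤ Ph K ψ 0 * R := hlow.trans hj
    rw [← mul_le_mul_iff_left₀ hRpos]
    refine le_trans ?_ h2
    rw [div_mul_eq_mul_div, div_mul_eq_mul_div, div_mul_eq_mul_div, div_le_div_iff₀ (by positivity) (by positivity)]
    nlinarith
  have h3 := pow_le_pow_left₀ (by have := ff_nonneg (K := K) 0; positivity) h1 k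
  rw [mul_pow, ff_pow hk, Ph, rt_pow hk ENNReal.toReal_nonneg] at h3
  have e1 : cap K ψ 0 = {w : Fin k → ℝ | ((0:G), w) ∈ K ∧ 0 ≤ ψ w} := by
    ext w
    simp [cap]
  rw [e1] at h3
  have hf : volume {w : Fin k → ℝ | ((0:G), w) ∈ K ∧ 0 ≤ ψ w} ≠ ⊤ := e1 ▸ cap_fin hK ψ 0
  have h4 := ENNReal.ofReal_le_ofReal h3
  rw [ENNReal.ofReal_mul (by positivity), ENNReal.ofReal_toReal hf,
    ENNReal.ofReal_toReal (sec_fin hK 0)] at h4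
  exact h4

end core2
end GDV

namespace GDV
open Set
open scoped ENNReal Pointwise

lemma transfer {n i : ℕ} (hi : 1 ≤ i) {K : Set (EuclideanSpace ℝ (Fin n))}
    (hKconv : Convex ℝ K) (hKcomp : IsCompact K) (hKint : (interior K).Nonempty)
    (hcentroid : (∫ x in K, x) = 0) (A : (Fin i → ℝ) →ₗ[ℝ] EuclideanSpace ℝ (Fin n))
    (hA : Function.Injective A) (ξ : EuclideanSpace ℝ (Fin n)) :
    ENNReal.ofReal (((i:ℝ) / ((n:ℝ) + 1)) ^ i) * volume {w : Fin i → ℝ | A w ∈ K} ≤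
      volume {w : Fin i → ℝ | A w ∈ K ∧ 0 ≤ ⟪A w, ξ⟫} := by
  obtain ⟨G, hG⟩ := Submodule.exists_isCompl (LinearMap.range A)
  let e1 : (G × (Fin i → ℝ)) ≃ₗ[ℝ] (G × LinearMap.range A) :=
    LinearEquiv.prodCongr (LinearEquiv.refl ℝ G) (LinearEquiv.ofInjective A hA)
  let e := e1.trans (Submodule.prodEquivOfIsCompl G (LinearMap.range A) hG.symm)
  have he : ∀ g w, e (g, w) = g + A w := by
    intro g w
    simp [e, e1]
  let L : (G × (Fin i → ℝ)) ≃L[ℝ] EuclideanSpace ℝ (Fin n) := e.toContinuousLinearEquiv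
  have hL : ∀ g w, L (g, w) = g + A w := he
  let μ : Measure G := Measure.addHaar
  have hmap : ((μ.prod volume).map L).IsAddHaarMeasure := L.isAddHaarMeasure_map _
  have hdim : Module.finrank ℝ G + i = n := by
    have := L.toLinearEquiv.finrank_eq
    simpa using this
  obtain ⟨c, hc0, hct, hce⟩ : ∃ c : ℝ≥0∞, c ≠ 0 ∧ c ≠ ⊤ ∧ (μ.prod volume).map L = c • volume := by
    refine ⟨Measure.addHaarScalarFactor ((μ.prod volume).map L) volume, ?_, ENNReal.coe_ne_top, ?_⟩
    · have := Measure.addHaarScalarFactor_pos_of_isAddHaarMeasure ((μ.prod volume).map L) (volume : Measure (EuclideanSpace ℝ (Fin n)))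
      exact_mod_cast this.ne'
    · exact Measure.isAddLeftInvariant_eq_smul _ _
  have hLe : MeasurableEmbedding L := L.toHomeomorph.measurableEmbedding
  have hK' : IsCompact (L ⁻¹' K) := L.toHomeomorph.isCompact_preimage.2 hKcomp
  have hKc' : Convex ℝ (L ⁻¹' K) := hKconv.linear_preimage e.toLinearMap
  let ψ : (Fin i → ℝ) →L[ℝ] ℝ := LinearMap.toContinuousLinearMap ((innerₛₗ ℝ ξ).comp A)
  have h0 : (μ.prod volume) (L ⁻¹' K) ≠ 0 := by
    rw [← hLe.map_apply, hce]
    simp only [Measure.smul_apply, smul_eq_mul, ne_eq, mul_eq_zero, hc0, false_or]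
    exact (Measure.measure_pos_of_nonempty_interior _ hKint).ne'
  have hcen : ∫ x in L ⁻¹' K, x ∂(μ.prod volume) = 0 := by
    apply L.injective
    rw [map_zero, ← L.integral_comp_comm]
    rw [← hLe.setIntegral_map (g := fun x => x), hce, Measure.restrict_smul, integral_smul_measure, hcentroid, smul_zero]
  have := core μ hK' hKc' ψ hi h0 hcen
  rw [hdim] at this
  have e1 : {w : Fin i → ℝ | ((0:G), w) ∈ L ⁻¹' K} = {w | A w ∈ K} := by
    ext w; simp [hL]
  have e2 : {w : Fin i → ℝ | ((0:G), w) ∈ L ⁻¹' K ∧ 0 ≤ ψ w} = {w | A w ∈ K ∧ 0 ≤ ⟪A w, ξ⟫} := by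
    ext w; simp [hL, ψ, real_inner_comm]
  rwa [e1, e2] at this
end GDV

namespace GDV
open Set
open scoped ENNReal Pointwise

lemma zero_mem_int {n : ℕ} {K : Set (EuclideanSpace ℝ (Fin n))}
    (hKconv : Convex ℝ K) (hKcomp : IsCompact K) (hKint : (interior K).Nonempty)
    (hcentroid : (∫ x in K, x) = 0) : (0 : EuclideanSpace ℝ (Fin n)) ∈ interior K := by
  obtain ⟨x, hx⟩ := hKint
  obtain ⟨r, hr, hrK⟩ := Metric.nhds_basis_closedBall.mem_iff.1 (isOpen_interior.mem_nhds hx)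
  have : IsFiniteMeasure (volume.restrict K) := ⟨by simpa using hKcomp.measure_lt_top⟩
  have hsub : Metric.closedBall x r ⊆ K := hrK.trans interior_subset
  have hpos : volume (Metric.closedBall x r) ≠ 0 := (Metric.measure_closedBall_pos volume x hr).ne'
  have hres : (volume.restrict K).restrict (Metric.closedBall x r) = volume.restrict (Metric.closedBall x r) := by
    rw [Measure.restrict_restrict Metric.isClosed_closedBall.measurableSet, inter_eq_left.2 hsub]
  have hIntg : IntegrableOn (fun x : EuclideanSpace ℝ (Fin n) => x) K :=
    continuous_id.continuousOn.integrableOn_compact hKcomp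
  have h := hKconv.average_mem_interior_of_set (μ := volume.restrict K) (f := fun x => x)
    (t := Metric.closedBall x r) ?_ ?_ hIntg ?_
  · rw [average_eq, hcentroid, smul_zero] at h
    exact h
  · rw [← Measure.restrict_apply_univ, hres]
    simpa using hpos
  · exact ae_restrict_mem hKcomp.measurableSet
  · rw [hres]
    apply hrK
    apply (convex_closedBall x r).set_average_mem Metric.isClosed_closedBall hpos
      (measure_closedBall_lt_top).ne
    · exact ae_restrict_mem Metric.isClosed_closedBall.measurableSet
    · exact hIntg.mono_set hsub

lemma vol_top {i : ℕ} {S : Set (Fin i → ℝ)} {w₀ : Fin i → ℝ} (hw : w₀ ≠ 0)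
    (hS : ∀ x ∈ S, ∀ m : ℕ, x + (m:ℝ) • w₀ ∈ S) (hIntg : (interior S).Nonempty) : volume S = ⊤ := by
  obtain ⟨x, hx⟩ := hIntg
  obtain ⟨r, hr, hrS⟩ := Metric.nhds_basis_ball.mem_iff.1 (isOpen_interior.mem_nhds hx)
  set ρ := min r (‖w₀‖ / 2) with hρ
  have hw' : 0 < ‖w₀‖ := norm_pos_iff.2 hw
  have hρ0 : 0 < ρ := lt_min hr (by positivity)
  have hsub : (⋃ m : ℕ, Metric.ball (x + (m:ℝ) • w₀) ρ) ⊆ S := by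
    refine iUnion_subset fun m y hy => ?_
    have := hS (y - (m:ℝ) • w₀) (interior_subset (hrS ?_)) m
    · simpa using this
    · rw [mem_ball_iff_norm] at hy ⊢
      have : y - (m:ℝ) • w₀ - x = y - (x + (m:ℝ) • w₀) := by abel
      rw [this]
      exact hy.trans_le (min_le_left _ _)
  refine top_le_iff.1 (le_trans ?_ (measure_mono hsub))
  rw [measure_iUnion]
  · simp_rw [Measure.addHaar_ball_center volume _ ρ]
    rw [ENNReal.tsum_const_eq_top_of_ne_zero (Metric.measure_ball_pos volume _ hρ0).ne']
  · intro m m' hmm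
    apply Metric.ball_disjoint_ball
    rw [dist_add_left, dist_eq_norm, ← sub_smul, norm_smul]
    have h1 : (1:ℝ) ≤ ‖(m:ℝ) - m'‖ := by
      rw [Real.norm_eq_abs]
      have : (1:ℤ) ≤ |(m:ℤ) - m'| := Int.one_le_abs (sub_ne_zero.2 (by exact_mod_cast hmm))
      exact_mod_cast this
    have := min_le_right r (‖w₀‖ / 2)
    nlinarith
  · intro m; exact Metric.isOpen_ball.measurableSet

lemma transfer_all {n i : ℕ} (hi : 1 ≤ i) {K : Set (EuclideanSpace ℝ (Fin n))}
    (hKconv : Convex ℝ K) (hKcomp : IsCompact K) (hKint : (interior K).Nonempty)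
    (hcentroid : (∫ x in K, x) = 0) (A : (Fin i → ℝ) →ₗ[ℝ] EuclideanSpace ℝ (Fin n))
    (ξ : EuclideanSpace ℝ (Fin n)) :
    ENNReal.ofReal (((i:ℝ) / ((n:ℝ) + 1)) ^ i) * volume {w : Fin i → ℝ | A w ∈ K} ≤
      volume {w : Fin i → ℝ | A w ∈ K ∧ 0 ≤ ⟪A w, ξ⟫} := by
  by_cases hA : Function.Injective A
  · exact transfer hi hKconv hKcomp hKint hcentroid A hA ξ
  obtain ⟨w₀, hw0, hw1⟩ : ∃ w, A w = 0 ∧ w ≠ 0 := by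
    rw [injective_iff_map_eq_zero] at hA
    push Not at hA
    exact hA
  have h0 := zero_mem_int hKconv hKcomp hKint hcentroid
  have hcA : Continuous A := A.continuous_of_finiteDimensional
  rw [vol_top hw1 (S := {w : Fin i → ℝ | A w ∈ K ∧ 0 ≤ ⟪A w, ξ⟫})]
  · exact le_top
  · intro x hx m
    simpa [hw0] using hx
  · by_cases hz : ∃ w, 0 < ⟪A w, ξ⟫
    · obtain ⟨w, hw⟩ := hz
      have hcont : Filter.Tendsto (fun t : ℝ => A (t • w)) (nhdsWithin 0 (Ioi 0)) (nhds 0) := by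
        have : Continuous (fun t : ℝ => A (t • w)) := by fun_prop
        have := (this.tendsto 0).mono_left (nhdsWithin_le_nhds (s := Ioi 0))
        simpa using this
      have hev := hcont.eventually (isOpen_interior.mem_nhds h0)
      obtain ⟨t, ht1, ht2⟩ := (hev.and self_mem_nhdsWithin).exists
      refine ⟨t • w, ?_⟩
      rw [mem_interior]
      refine ⟨{w | A w ∈ interior K ∧ 0 < ⟪A w, ξ⟫}, ?_, ?_, ?_, ?_⟩
      · rintro y ⟨h1, h2⟩
        exact ⟨interior_subset h1, h2.le⟩
      · have o2 : IsOpen {w | 0 < ⟪A w, ξ⟫} :=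
          isOpen_lt continuous_const (hcA.inner (𝕜 := ℝ) continuous_const)
        exact (isOpen_interior.preimage hcA).inter o2
      · exact ht1
      · rw [map_smul, real_inner_smul_left]
        exact mul_pos ht2 hw
    · push Not at hz
      refine ⟨0, ?_⟩
      rw [mem_interior]
      refine ⟨A ⁻¹' interior K, ?_, isOpen_interior.preimage hcA, by simpa using h0⟩
      intro y hy
      refine ⟨interior_subset (mem_preimage.1 hy), ?_⟩
      have := hz (-y)
      rw [map_neg, inner_neg_left] at this
      linarith
end GDV

namespace GDV
open Set
open scoped ENNReal Pointwise

/-- Gaussian density. -/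
noncomputable def gd {k : ℕ} (y : EuclideanSpace ℝ (Fin k)) : ℝ≥0∞ :=
  ENNReal.ofReal (Real.exp (-Real.pi * ‖y‖ ^ 2))

noncomputable def gau (k : ℕ) : Measure (EuclideanSpace ℝ (Fin k)) := volume.withDensity gd

lemma gd_meas {k : ℕ} : Measurable (gd (k := k)) := by unfold gd; fun_prop

lemma gau_charFun {k : ℕ} (t : EuclideanSpace ℝ (Fin k)) :
    charFun (gau k) t = Complex.exp (-(‖t‖ ^ 2 / (4 * Real.pi) : ℝ)) := by
  rw [charFun_apply, gau, integral_withDensity_eq_integral_toReal_smul gd_meas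
    (Filter.Eventually.of_forall fun x => ENNReal.ofReal_lt_top)]
  have h := GaussianFourier.integral_cexp_neg_mul_sq_norm_add (b := (Real.pi : ℂ)) (by simpa using Real.pi_pos) Complex.I t
  have hpi : (Real.pi : ℂ) ≠ 0 := by exact_mod_cast Real.pi_ne_zero
  rw [div_self hpi, Complex.one_cpow, one_mul, Complex.I_sq] at h
  convert h using 1
  · apply integral_congr_ae
    refine Filter.Eventually.of_forall fun x => ?_
    simp only [gd]
    rw [ENNReal.toReal_ofReal (Real.exp_pos _).le, Complex.exp_add, Complex.real_smul,
      real_inner_comm, mul_comm Complex.I]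
    push_cast
    rfl
  · congr 1
    push_cast
    ring

instance {k : ℕ} : IsProbabilityMeasure (gau k) := by
  constructor
  rw [gau, withDensity_apply _ MeasurableSet.univ, Measure.restrict_univ]
  unfold gd
  have h := GaussianFourier.integral_rexp_neg_mul_sq_norm (V := EuclideanSpace ℝ (Fin k)) Real.pi_pos
  rw [div_self Real.pi_ne_zero, Real.one_rpow] at h
  rw [← ofReal_integral_eq_lintegral_ofReal, h, ENNReal.ofReal_one]
  · by_contra hc
    rw [integral_undef hc] at h
    norm_num at h
  · exact Filter.Eventually.of_forall fun x => (Real.exp_pos _).le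

/-- combination -/
noncomputable def cmb {i k : ℕ} (a : Fin i → EuclideanSpace ℝ (Fin k)) (w : EuclideanSpace ℝ (Fin i)) :
    EuclideanSpace ℝ (Fin k) := ∑ j, w j • a j

lemma cmb_cont {i k : ℕ} : Continuous (fun p : (Fin i → EuclideanSpace ℝ (Fin k)) × EuclideanSpace ℝ (Fin i) =>
    cmb p.1 p.2) := by
  unfold cmb; fun_prop

noncomputable def PP (i k : ℕ) : Measure (Fin i → EuclideanSpace ℝ (Fin k)) :=
  Measure.pi (fun _ => gau k)

instance {i k : ℕ} : IsProbabilityMeasure (PP i k) := by unfold PP; infer_instance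

lemma law {i k : ℕ} (w : EuclideanSpace ℝ (Fin i)) :
    (PP i k).map (fun a => cmb a w) = (gau k).map (fun z => ‖w‖ • z) := by
  have hm1 : Measurable (fun a : Fin i → EuclideanSpace ℝ (Fin k) => cmb a w) :=
    (cmb_cont.comp (continuous_id.prodMk continuous_const)).measurable
  have hm2 : Measurable (fun z : EuclideanSpace ℝ (Fin k) => ‖w‖ • z) := by fun_prop
  have := Measure.isProbabilityMeasure_map (μ := PP i k) hm1.aemeasurable
  have := Measure.isProbabilityMeasure_map (μ := gau k) hm2.aemeasurable
  apply Measure.ext_of_charFun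
  ext t
  rw [charFun_map_smul, gau_charFun, charFun_apply, integral_map hm1.aemeasurable (by fun_prop)]
  have : ∀ a : Fin i → EuclideanSpace ℝ (Fin k),
      Complex.exp (⟪cmb a w, t⟫ * Complex.I) = ∏ j, Complex.exp (⟪a j, w j • t⟫ * Complex.I) := by
    intro a
    rw [← Complex.exp_sum, ← Finset.sum_mul]
    simp only [cmb, sum_inner, real_inner_smul_left, real_inner_smul_right]
    push_cast
    rfl
  simp_rw [this]
  rw [PP, integral_fintype_prod_eq_prod (f := fun j (x : EuclideanSpace ℝ (Fin k)) => Complex.exp (⟪x, w j • t⟫ * Complex.I))]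
  have h2 : ∀ j : Fin i, ∫ x : EuclideanSpace ℝ (Fin k), Complex.exp (⟪x, w j • t⟫ * Complex.I) ∂(gau k) =
      Complex.exp (-(‖w j • t‖ ^ 2 / (4 * Real.pi) : ℝ)) := by
    intro j
    rw [← gau_charFun, charFun_apply]
  rw [Finset.prod_congr rfl (fun j _ => h2 j), ← Complex.exp_sum]
  congr 1
  simp only [norm_smul, mul_pow, norm_norm, Finset.sum_neg_distrib]
  rw [EuclideanSpace.norm_sq_eq w, ← Complex.ofReal_sum, ← Finset.sum_div, ← Finset.sum_mul]

lemma lint_smul {d : ℕ} {r : ℝ} (hr : 0 < r) {f : EuclideanSpace ℝ (Fin d) → ℝ≥0∞} (hf : Measurable f) :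
    ∫⁻ x, f (r • x) = ENNReal.ofReal ((r ^ d)⁻¹) * ∫⁻ x, f x := by
  rw [← lintegral_map (f := f) (g := fun x => r • x) hf (by fun_prop), Measure.map_addHaar_smul _ hr.ne',
    lintegral_smul_measure, abs_of_pos (by positivity), smul_eq_mul]
  simp

end GDV

namespace GDV
open Set
open scoped ENNReal Pointwise

noncomputable def ci (i k : ℕ) (v : EuclideanSpace ℝ (Fin i)) : ℝ≥0∞ :=
  ENNReal.ofReal ((‖v‖ ^ k)⁻¹ * Real.exp (-Real.pi * (‖v‖⁻¹) ^ 2))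

lemma ci_meas (i k : ℕ) : Measurable (ci i k) := by unfold ci; fun_prop

lemma ci_bound {k : ℕ} (hk : 1 ≤ k) {t : ℝ} (ht : 0 ≤ t) :
    (t ^ k)⁻¹ * Real.exp (-Real.pi * (t⁻¹) ^ 2) ≤ (2 * k : ℝ) ^ k * (1 + t) ^ (-(k:ℝ)) := by
  rcases ht.eq_or_lt with rfl | ht
  · rw [zero_pow (by omega)]
    simp only [inv_zero, zero_mul]
    positivity
  have hkr : (1:ℝ) ≤ k := by exact_mod_cast hk
  set s := t⁻¹ with hs
  have hs0 : 0 < s := by positivity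
  have h1 : 1 + s ≤ 2 * k * Real.exp (s ^ 2 / k) := by
    have h2 := Real.add_one_le_exp (s ^ 2 / k)
    have h3 : 2 * (k:ℝ) * (s ^ 2 / k + 1) = 2 * s ^ 2 + 2 * k := by field_simp
    have h4 : 2 * (k:ℝ) * (s ^ 2 / k + 1) ≤ 2 * k * Real.exp (s ^ 2 / k) := by gcongr
    nlinarith [sq_nonneg (s - 1)]
  have h2 := pow_le_pow_left₀ (by positivity) h1 k
  rw [mul_pow, ← Real.exp_nat_mul, mul_div_cancel₀ _ (by positivity)] at h2
  have h3 : Real.exp (s ^ 2) ≤ Real.exp (Real.pi * s ^ 2) := by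
    apply Real.exp_le_exp.2
    nlinarith [Real.pi_gt_three, sq_nonneg s]
  have h4 : (1 + s) ^ k ≤ (2 * k : ℝ) ^ k * Real.exp (Real.pi * s ^ 2) := h2.trans (by gcongr)
  have h5 : (1 + t) = t * (1 + s) := by rw [hs]; field_simp; ring
  rw [Real.rpow_neg (by positivity), Real.rpow_natCast, h5, mul_pow t, mul_inv, neg_mul, Real.exp_neg,
    mul_left_comm]
  gcongr
  rw [← div_eq_mul_inv, inv_eq_one_div, div_le_div_iff₀ (Real.exp_pos _) (by positivity), one_mul]
  exact h4

lemma ci_fin {i k : ℕ} (hik : i < k) : ∫⁻ v, ci i k v ≠ ⊤ := by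
  have h := finite_integral_one_add_norm (E := EuclideanSpace ℝ (Fin i)) (μ := volume) (r := (k:ℝ))
    (by simpa using hik)
  have : ∫⁻ v, ci i k v ≤ ENNReal.ofReal ((2 * k : ℝ) ^ k) *
      ∫⁻ x : EuclideanSpace ℝ (Fin i), ENNReal.ofReal ((1 + ‖x‖) ^ (-(k:ℝ))) := by
    rw [← lintegral_const_mul _ (by fun_prop)]
    apply lintegral_mono
    intro v
    simp only
    rw [← ENNReal.ofReal_mul (by positivity)]
    exact ENNReal.ofReal_le_ofReal (ci_bound (by omega) (norm_nonneg v))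
  exact (this.trans_lt (ENNReal.mul_lt_top ENNReal.ofReal_lt_top h)).ne

lemma ae_ne {d : ℕ} (hd : 1 ≤ d) : ∀ᵐ v : EuclideanSpace ℝ (Fin d), v ≠ 0 := by
  have : Nonempty (Fin d) := ⟨⟨0, hd⟩⟩
  have : Nontrivial (EuclideanSpace ℝ (Fin d)) := inferInstance
  exact Measure.ae_ne volume 0

lemma ci_pos {i k : ℕ} (hi : 1 ≤ i) : ∫⁻ v, ci i k v ≠ 0 := by
  rw [Ne, lintegral_eq_zero_iff (ci_meas i k)]
  intro h
  have h2 : ∀ᵐ v : EuclideanSpace ℝ (Fin i), False := by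
    filter_upwards [h, ae_ne hi] with v hv hv0
    have : 0 < ‖v‖ := norm_pos_iff.2 hv0
    have h3 : (0:ℝ) < (‖v‖ ^ k)⁻¹ * Real.exp (-Real.pi * (‖v‖⁻¹) ^ 2) := by positivity
    simp only [ci, Pi.zero_apply, ENNReal.ofReal_eq_zero] at hv
    linarith
  rw [Filter.eventually_false_iff_eq_bot, ae_eq_bot] at h2
  exact NeZero.ne _ h2

lemma key {i k : ℕ} (hi : 1 ≤ i) (hik : i < k) {D : Set (EuclideanSpace ℝ (Fin k))}
    (hD : MeasurableSet D) :
    ∫⁻ a, volume {w : EuclideanSpace ℝ (Fin i) | cmb a w ∈ D} ∂(PP i k) =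
      (∫⁻ v, ci i k v) * ∫⁻ y in D, ENNReal.ofReal (‖y‖ ^ ((i:ℝ) - k)) := by
  set S : Set ((Fin i → EuclideanSpace ℝ (Fin k)) × EuclideanSpace ℝ (Fin i)) :=
    {p | cmb p.1 p.2 ∈ D} with hS
  have hSm : MeasurableSet S := cmb_cont.measurable hD
  have e1 := Measure.prod_apply (μ := PP i k) (ν := volume) hSm
  have e2 := Measure.prod_apply_symm (μ := PP i k) (ν := volume) hSm
  have step1 : ∀ᵐ w : EuclideanSpace ℝ (Fin i), (PP i k) ((fun a => (a, w)) ⁻¹' S) =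
      ∫⁻ y, D.indicator 1 y * (ENNReal.ofReal ((‖w‖ ^ k)⁻¹) * gd (‖w‖⁻¹ • y)) := by
    filter_upwards [ae_ne hi] with w hw
    have hw0 : 0 < ‖w‖ := norm_pos_iff.2 hw
    have hm1 : Measurable (fun a : Fin i → EuclideanSpace ℝ (Fin k) => cmb a w) :=
      (cmb_cont.comp (continuous_id.prodMk continuous_const)).measurable
    have hm2 : Measurable (fun z : EuclideanSpace ℝ (Fin k) => ‖w‖ • z) := by fun_prop
    have hgm : Measurable (fun y : EuclideanSpace ℝ (Fin k) => gd (‖w‖⁻¹ • y)) :=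
      gd_meas.comp (by fun_prop)
    have h1 : (PP i k) ((fun a => (a, w)) ⁻¹' S) = ((PP i k).map (fun a => cmb a w)) D := by
      rw [Measure.map_apply hm1 hD]; rfl
    have hFm : Measurable (fun y => D.indicator 1 y * gd (‖w‖⁻¹ • y)) :=
      (measurable_one.indicator hD).mul hgm
    have h2 := lint_smul hw0 hFm
    rw [h1, law, Measure.map_apply hm2 hD, gau, withDensity_apply _ (hm2 hD),
      ← lintegral_indicator (hm2 hD)]
    calc _ = ∫⁻ z, D.indicator 1 (‖w‖ • z) * gd (‖w‖⁻¹ • ‖w‖ • z) := by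
          congr 1
          ext z
          rw [smul_smul, inv_mul_cancel₀ hw0.ne', one_smul]
          by_cases hz : ‖w‖ • z ∈ D
          · rw [indicator_of_mem (by exact hz), indicator_of_mem hz]; simp
          · rw [indicator_of_notMem (by exact hz), indicator_of_notMem hz]; simp
      _ = _ := h2
      _ = _ := by
          rw [← lintegral_const_mul _ hFm]
          congr 1
          ext y
          ring
  have hjm : Measurable (fun p : EuclideanSpace ℝ (Fin i) × EuclideanSpace ℝ (Fin k) =>
      D.indicator (1 : EuclideanSpace ℝ (Fin k) → ℝ≥0∞) p.2 * (ENNReal.ofReal ((‖p.1‖ ^ k)⁻¹) * gd (‖p.1‖⁻¹ • p.2))) := by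
    have m1 : Measurable (fun p : EuclideanSpace ℝ (Fin i) × EuclideanSpace ℝ (Fin k) =>
        gd (‖p.1‖⁻¹ • p.2)) := gd_meas.comp (by fun_prop)
    have m2 : Measurable (fun p : EuclideanSpace ℝ (Fin i) × EuclideanSpace ℝ (Fin k) =>
        D.indicator (1 : EuclideanSpace ℝ (Fin k) → ℝ≥0∞) p.2) :=
      (measurable_one.indicator hD).comp measurable_snd
    fun_prop
  have step2 : ∀ᵐ y : EuclideanSpace ℝ (Fin k),
      ∫⁻ w : EuclideanSpace ℝ (Fin i), ENNReal.ofReal ((‖w‖ ^ k)⁻¹) * gd (‖w‖⁻¹ • y) =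
      (∫⁻ v, ci i k v) * ENNReal.ofReal (‖y‖ ^ ((i:ℝ) - k)) := by
    filter_upwards [ae_ne (by omega : 1 ≤ k)] with y hy
    have hy0 : 0 < ‖y‖ := norm_pos_iff.2 hy
    have hHm : Measurable (fun w : EuclideanSpace ℝ (Fin i) =>
        ENNReal.ofReal ((‖w‖ ^ k)⁻¹) * gd (‖w‖⁻¹ • y)) :=
      Measurable.mul (by fun_prop) (gd_meas.comp (by fun_prop))
    have h1 := lint_smul hy0 hHm
    have h2 : ∀ v : EuclideanSpace ℝ (Fin i),
        ENNReal.ofReal ((‖‖y‖ • v‖ ^ k)⁻¹) * gd (‖‖y‖ • v‖⁻¹ • y) =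
        ENNReal.ofReal ((‖y‖ ^ k)⁻¹) * ci i k v := by
      intro v
      unfold gd ci
      rw [← ENNReal.ofReal_mul (by positivity), ← ENNReal.ofReal_mul (by positivity), ← mul_assoc]
      congr 2
      · rw [norm_smul, norm_norm, mul_pow, mul_inv]
      · rw [norm_smul, norm_smul, norm_norm, norm_inv, norm_mul, norm_norm, norm_norm, mul_inv]
        congr 3
        field_simp
    simp_rw [h2] at h1
    rw [lintegral_const_mul _ (ci_meas i k)] at h1
    have h3 : ENNReal.ofReal (‖y‖ ^ i) * ENNReal.ofReal ((‖y‖ ^ i)⁻¹) = 1 := by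
      rw [← ENNReal.ofReal_mul (by positivity), mul_inv_cancel₀ (by positivity), ENNReal.ofReal_one]
    have h4 : ENNReal.ofReal (‖y‖ ^ ((i:ℝ) - k)) = ENNReal.ofReal (‖y‖ ^ i) * ENNReal.ofReal ((‖y‖ ^ k)⁻¹) := by
      rw [← ENNReal.ofReal_mul (by positivity), Real.rpow_sub hy0, Real.rpow_natCast, Real.rpow_natCast,
        div_eq_mul_inv]
    rw [h4, mul_comm (∫⁻ v, ci i k v), mul_assoc, h1, ← mul_assoc, h3, one_mul]
  calc _ = ((PP i k).prod volume) S := by rw [e1]; rfl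
    _ = ∫⁻ w, ∫⁻ y, D.indicator 1 y * (ENNReal.ofReal ((‖w‖ ^ k)⁻¹) * gd (‖w‖⁻¹ • y)) := by
        rw [e2]; exact lintegral_congr_ae step1
    _ = ∫⁻ y, ∫⁻ w : EuclideanSpace ℝ (Fin i), D.indicator 1 y * (ENNReal.ofReal ((‖w‖ ^ k)⁻¹) * gd (‖w‖⁻¹ • y)) :=
        lintegral_lintegral_swap hjm.aemeasurable
    _ = ∫⁻ y, D.indicator (fun y => (∫⁻ v, ci i k v) * ENNReal.ofReal (‖y‖ ^ ((i:ℝ) - k))) y := by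
        apply lintegral_congr_ae
        filter_upwards [step2] with y hy
        rw [lintegral_const_mul, hy]
        · by_cases h : y ∈ D <;> simp [h]
        · exact Measurable.mul (by fun_prop) (gd_meas.comp (by fun_prop))
    _ = _ := by
        rw [lintegral_indicator hD, lintegral_const_mul _ (by fun_prop)]

end GDV

namespace GDV
open Set
open scoped ENNReal Pointwise

lemma transfer_euc {n i k : ℕ} (hi : 1 ≤ i) {K : Set (EuclideanSpace ℝ (Fin n))}
    (hKconv : Convex ℝ K) (hKcomp : IsCompact K) (hKint : (interior K).Nonempty)
    (hcentroid : (∫ x in K, x) = 0)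
    (B : EuclideanSpace ℝ (Fin i) →ₗ[ℝ] EuclideanSpace ℝ (Fin k))
    (J : EuclideanSpace ℝ (Fin k) →ₗ[ℝ] EuclideanSpace ℝ (Fin n))
    (ξ : EuclideanSpace ℝ (Fin n)) :
    ENNReal.ofReal (((i:ℝ) / ((n:ℝ) + 1)) ^ i) *
        volume {w : EuclideanSpace ℝ (Fin i) | B w ∈ J ⁻¹' K} ≤
      volume {w : EuclideanSpace ℝ (Fin i) | B w ∈ J ⁻¹' (K ∩ {x | 0 ≤ ⟪x, ξ⟫})} := by
  have h := transfer_all hi hKconv hKcomp hKint hcentroid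
    ((J.comp B).comp (WithLp.linearEquiv 2 ℝ (Fin i → ℝ)).symm.toLinearMap) ξ
  have hmp := PiLp.volume_preserving_toLp (Fin i)
  have hme := (MeasurableEquiv.toLp 2 (Fin i → ℝ)).measurableEmbedding
  have e : ∀ T : Set (EuclideanSpace ℝ (Fin i)), volume (WithLp.toLp 2 ⁻¹' T) = volume T :=
    fun T => hmp.measure_preimage_emb hme T
  rw [← e, ← e]
  exact h

lemma cmb_lin {i k : ℕ} (a : Fin i → EuclideanSpace ℝ (Fin k)) :
    ∃ B : EuclideanSpace ℝ (Fin i) →ₗ[ℝ] EuclideanSpace ℝ (Fin k), ∀ w, B w = cmb a w := by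
  refine ⟨{ toFun := cmb a, map_add' := ?_, map_smul' := ?_ }, fun w => rfl⟩
  · intro x y; simp [cmb, add_smul, Finset.sum_add_distrib]
  · intro r x; simp [cmb, mul_smul, Finset.smul_sum]

lemma lint_ineq {n i k : ℕ} (hi : 1 ≤ i) (hik : i ≤ k) {K : Set (EuclideanSpace ℝ (Fin n))}
    (hKconv : Convex ℝ K) (hKcomp : IsCompact K) (hKint : (interior K).Nonempty)
    (hcentroid : (∫ x in K, x) = 0)
    (J : EuclideanSpace ℝ (Fin k) →ₗ[ℝ] EuclideanSpace ℝ (Fin n))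
    (ξ : EuclideanSpace ℝ (Fin n)) :
    ENNReal.ofReal (((i:ℝ) / ((n:ℝ) + 1)) ^ i) *
        ∫⁻ y in J ⁻¹' K, ENNReal.ofReal (‖y‖ ^ ((i:ℝ) - k)) ≤
      ∫⁻ y in J ⁻¹' (K ∩ {x | 0 ≤ ⟪x, ξ⟫}), ENNReal.ofReal (‖y‖ ^ ((i:ℝ) - k)) := by
  have hJ : Continuous J := J.continuous_of_finiteDimensional
  have m1 : MeasurableSet (J ⁻¹' K) := hJ.measurable hKcomp.measurableSet
  have m0 : IsClosed {x | 0 ≤ ⟪x, ξ⟫} :=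
    isClosed_le continuous_const (continuous_id.inner (𝕜 := ℝ) continuous_const)
  have m2 : MeasurableSet (J ⁻¹' (K ∩ {x | 0 ≤ ⟪x, ξ⟫})) :=
    hJ.measurable (hKcomp.measurableSet.inter m0.measurableSet)
  rcases hik.eq_or_lt with rfl | hlt
  · have h := transfer_euc hi hKconv hKcomp hKint hcentroid LinearMap.id J ξ
    simp only [sub_self, Real.rpow_zero, ENNReal.ofReal_one, setLIntegral_one]
    exact h
  · have k1 := key hi hlt m1
    have k2 := key hi hlt m2
    have hC0 := ci_pos (k := k) hi
    have hCt := ci_fin hlt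
    rw [← ENNReal.mul_le_mul_iff_right hC0 hCt, ← k2, mul_left_comm, ← k1, ← lintegral_const_mul']
    · apply lintegral_mono
      intro a
      obtain ⟨B, hB⟩ := cmb_lin a
      have h := transfer_euc hi hKconv hKcomp hKint hcentroid B J ξ
      simp only [hB] at h
      exact h
    · exact ENNReal.ofReal_ne_top

end GDV

theorem gruenbaum_dual_volumes_sections (n k i : ℕ) (hi : 1 ≤ i) (hik : i ≤ k) (hkn : k ≤ n)
    (K : Set (EuclideanSpace ℝ (Fin n)))
    (hKconv : Convex ℝ K) (hKcomp : IsCompact K) (hKint : (interior K).Nonempty)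
    (hcentroid : (∫ x in K, x) = 0)
    (E : Submodule ℝ (EuclideanSpace ℝ (Fin n))) (hE : Module.finrank ℝ E = k)
    (ξ : EuclideanSpace ℝ (Fin n)) (hξ : ‖ξ‖ = 1) (hξE : ξ ∈ E) :
    ((i : ℝ) / ((n : ℝ) + 1)) ^ i *
        ((i : ℝ) / (k : ℝ) * ∫ y in K ∩ (E : Set _), ‖y‖ ^ ((i : ℝ) - k) ∂μH[(k : ℝ)]) ≤
      (i : ℝ) / (k : ℝ) *
        ∫ y in K ∩ (E : Set _) ∩ {x | 0 ≤ ⟪x, ξ⟫}, ‖y‖ ^ ((i : ℝ) - k) ∂μH[(k : ℝ)] := by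
  let b := (stdOrthonormalBasis ℝ E).reindex (finCongr hE)
  let J : EuclideanSpace ℝ (Fin k) →ₗᵢ[ℝ] EuclideanSpace ℝ (Fin n) :=
    E.subtypeₗᵢ.comp b.repr.symm.toLinearIsometry
  have hrange : Set.range J = (E : Set (EuclideanSpace ℝ (Fin n))) := by
    ext x
    constructor
    · rintro ⟨y, rfl⟩
      exact (b.repr.symm y).2
    · intro hx
      exact ⟨b.repr ⟨x, hx⟩, by simp [J]⟩
  have hEmb : MeasurableEmbedding J := J.isometry.isClosedEmbedding.measurableEmbedding
  have hmapJ : Measure.map J (μH[(k:ℝ)] : Measure (EuclideanSpace ℝ (Fin k))) = (μH[(k:ℝ)]).restrict (E : Set (EuclideanSpace ℝ (Fin n))) := by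
    rw [J.isometry.map_hausdorffMeasure (Or.inl (Nat.cast_nonneg k)), hrange]
  have hH : (μH[(k:ℝ)] : Measure (EuclideanSpace ℝ (Fin k))).IsAddHaarMeasure := by
    have := isAddHaarMeasure_hausdorffMeasure (E := EuclideanSpace ℝ (Fin k))
    simpa using this
  obtain ⟨c, hc⟩ : ∃ c : NNReal, (μH[(k:ℝ)] : Measure (EuclideanSpace ℝ (Fin k))) = c • volume :=
    ⟨_, Measure.isAddLeftInvariant_eq_smul _ _⟩
  -- set lintegrals
  have hl : ∀ T : Set (EuclideanSpace ℝ (Fin n)), MeasurableSet T →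
      ∫⁻ y in T ∩ (E : Set _), ENNReal.ofReal (‖y‖ ^ ((i:ℝ) - k)) ∂μH[(k:ℝ)] =
      c * ∫⁻ y in J ⁻¹' T, ENNReal.ofReal (‖y‖ ^ ((i:ℝ) - k)) := by
    intro T hT
    rw [← Measure.restrict_restrict hT, ← hmapJ, hEmb.restrict_map, hEmb.lintegral_map, hc,
      Measure.restrict_smul, lintegral_smul_measure]
    simp only [J.norm_map]
    rfl
  have m0 : IsClosed {x : EuclideanSpace ℝ (Fin n) | 0 ≤ ⟪x, ξ⟫} :=
    isClosed_le continuous_const (continuous_id.inner (𝕜 := ℝ) continuous_const)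
  have hm := GDV.lint_ineq hi hik hKconv hKcomp hKint hcentroid J.toLinearMap ξ
  have hm2 : ENNReal.ofReal (((i:ℝ) / ((n:ℝ) + 1)) ^ i) *
      ∫⁻ y in K ∩ (E : Set _), ENNReal.ofReal (‖y‖ ^ ((i:ℝ) - k)) ∂μH[(k:ℝ)] ≤
      ∫⁻ y in K ∩ (E : Set _) ∩ {x | 0 ≤ ⟪x, ξ⟫}, ENNReal.ofReal (‖y‖ ^ ((i:ℝ) - k)) ∂μH[(k:ℝ)] := by
    rw [Set.inter_right_comm, hl K hKcomp.measurableSet,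
      hl _ (hKcomp.measurableSet.inter m0.measurableSet), mul_left_comm]
    gcongr
    exact hm
  rw [mul_left_comm]
  refine mul_le_mul_of_nonneg_left ?_ (by positivity)
  by_cases hIntg : IntegrableOn (fun y : EuclideanSpace ℝ (Fin n) => ‖y‖ ^ ((i : ℝ) - k)) (K ∩ (E : Set _)) μH[(k : ℝ)]
  · have hIntg2 := hIntg.mono_set (s := K ∩ (E : Set _) ∩ {x | 0 ≤ ⟪x, ξ⟫}) Set.inter_subset_left
    have hnn : ∀ y : EuclideanSpace ℝ (Fin n), 0 ≤ ‖y‖ ^ ((i : ℝ) - k) :=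
      fun y => Real.rpow_nonneg (norm_nonneg y) _
    rw [← ofReal_integral_eq_lintegral_ofReal hIntg (Filter.Eventually.of_forall hnn),
      ← ofReal_integral_eq_lintegral_ofReal hIntg2 (Filter.Eventually.of_forall hnn),
      ← ENNReal.ofReal_mul (by positivity)] at hm2
    exact (ENNReal.ofReal_le_ofReal_iff (integral_nonneg hnn)).1 hm2
  · rw [integral_undef hIntg, mul_zero]
    exact integral_nonneg fun y => Real.rpow_nonneg (norm_nonneg y) _
end
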